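/- arXiv:2112.04395 — 2 statements merged into one kernel-verified Lean document; each statement's English description precedes it below -/
import Mathlib

section
/- With high probability, for every integer y with |y − n/2| < (1/2)·√(n·ln n·(1−ζ₂)) + 1, it holds that N_y ≥ (ln n)^{5/4} and |N_y − N_{y+1}| ≤ N_y / ln ln n. -/
open Filter

/-- The degree of a vertex in a (possibly non-decidable) simple graph. -/
noncomputable def ndeg {V : Type*} (G : SimpleGraph V) (v : V) : ℕ :=
  Nat.card (G.neighborSet v)

/-- The probability that a uniformly random graph on the (finite) vertex type `V`
belongs to the set `A`. -/
noncomputable def gprob {V : Type*} (A : Set (SimpleGraph V)) : ℝ :=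
  (Nat.card A : ℝ) / 2 ^ (Nat.card V).choose 2

/-- `N_y`: the number of vertices of degree `y` in a graph on `Fin n`. -/
noncomputable def Ncount {n : ℕ} (G : SimpleGraph (Fin n)) (y : ℤ) : ℕ :=
  Set.ncard {v : Fin n | (ndeg G v : ℤ) = y}

/-- `ζ₁ = (ln(2π) + (3/2)·ln ln n) / ln n`. -/
noncomputable def zeta1 (n : ℕ) : ℝ :=
  (Real.log (2 * Real.pi) + (3 / 2) * Real.log (Real.log n)) / Real.log n

/-- `ζ₂ = (ln(2π) + (5/2)·ln ln n) / ln n`. -/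
noncomputable def zeta2 (n : ℕ) : ℝ :=
  (Real.log (2 * Real.pi) + (5 / 2) * Real.log (Real.log n)) / Real.log n

theorem ndeg_eq_card {V : Type*} [Fintype V] (G : SimpleGraph V) [DecidableRel G.Adj] (v : V) :
    ndeg G v = (G.neighborFinset v).card := by
  rw [ndeg, Nat.card_eq_fintype_card, SimpleGraph.neighborFinset, Set.toFinset_card]

theorem card_simpleGraph (V : Type*) [Finite V] :
    Nat.card (SimpleGraph V) = 2 ^ (Nat.card V).choose 2 := by
  classical
  have := Fintype.ofFinite V
  let e : SimpleGraph V ≃ Set {e : Sym2 V // ¬ e.IsDiag} :=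
    { toFun := fun G => {e | e.1 ∈ G.edgeSet}
      invFun := fun A => SimpleGraph.fromEdgeSet (Subtype.val '' A)
      left_inv := fun G => by
        ext a b
        simp only [SimpleGraph.fromEdgeSet_adj]
        constructor
        · rintro ⟨⟨⟨x, hx⟩, h1, rfl⟩, h2⟩
          exact h1
        · intro h
          exact ⟨⟨⟨s(a, b), by simpa using h.ne⟩, h, rfl⟩, h.ne⟩
      right_inv := fun A => by
        ext ⟨x, hx⟩
        simp [SimpleGraph.edgeSet_fromEdgeSet, hx] }
  rw [Nat.card_congr e, Nat.card_eq_fintype_card, Fintype.card_set,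
    Sym2.card_subtype_not_diag, Nat.card_eq_fintype_card]

/-- The graph joining every vertex `a` to the elements of `T a`. -/
def starGraph {V : Type*} (T : V → Finset V) : SimpleGraph V :=
  SimpleGraph.fromRel fun a b => b ∈ T a

theorem neighborFinset_symmDiff_starGraph {V : Type*} [Fintype V] [DecidableEq V]
    (G : SimpleGraph V) {S : Finset V} {T : V → Finset V} [DecidableRel G.Adj]
    [DecidableRel (symmDiff G (starGraph T)).Adj] (hT : ∀ a, T a ⊆ Sᶜ) {v : V} (hv : v ∈ S) :
    (symmDiff G (starGraph T)).neighborFinset v = symmDiff (G.neighborFinset v) (T v) := by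
  have h1 : ∀ a, v ∉ T a := fun a h => by simpa [hv] using hT a h
  ext w
  have h2 : w ∈ T v → v ≠ w := fun h e => h1 v (e ▸ h)
  rw [SimpleGraph.mem_neighborFinset, Finset.mem_symmDiff, SimpleGraph.mem_neighborFinset]
  simp only [symmDiff, SimpleGraph.sup_adj, SimpleGraph.sdiff_adj, starGraph,
    SimpleGraph.fromRel_adj, h1, or_false]
  tauto

theorem sum_powerset_card_symmDiff {V : Type*} [Fintype V] [DecidableEq V] (S A : Finset V)
    (f : ℕ → ℝ) :
    ∑ T ∈ Sᶜ.powerset, f (symmDiff A T).card =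
      ∑ k ∈ Finset.range (Sᶜ.card + 1), (Sᶜ.card.choose k : ℝ) * f ((A ∩ S).card + k) := by
  have h := Finset.sum_powerset_apply_card (fun k => f ((A ∩ S).card + k)) (x := Sᶜ)
  simp only [nsmul_eq_mul] at h
  rw [← h]
  refine Finset.sum_bij' (fun T _ => symmDiff (A ∩ Sᶜ) T) (fun T _ => symmDiff (A ∩ Sᶜ) T)
    ?_ ?_ ?_ ?_ ?_
  · intro T hT
    rw [Finset.mem_powerset] at hT ⊢
    intro x hx
    have := @hT x
    simp only [Finset.mem_symmDiff, Finset.mem_inter] at hx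
    tauto
  · intro T hT
    rw [Finset.mem_powerset] at hT ⊢
    intro x hx
    have := @hT x
    simp only [Finset.mem_symmDiff, Finset.mem_inter] at hx
    tauto
  · intro T _
    simp
  · intro T _
    simp
  · intro T hT
    congr 1
    rw [← Finset.card_union_of_disjoint]
    · congr 1
      ext x
      have : x ∈ T → x ∉ S := fun h => by simpa using Finset.mem_powerset.1 hT h
      simp only [Finset.mem_symmDiff, Finset.mem_inter, Finset.mem_union, Finset.mem_compl]
      tauto
    · rw [Finset.disjoint_left]
      intro x hx hx'
      have : x ∈ T → x ∉ S := fun h => by simpa using Finset.mem_powerset.1 hT h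
      simp only [Finset.mem_symmDiff, Finset.mem_inter, Finset.mem_compl] at hx hx'
      tauto

/-- If, for each `v ∈ S`, the average of `f v (d + Bin(|Sᶜ|, 1/2))` is at most `c v` in absolute
value for all `d < |S|`, then the average of `∏ v, f v (deg v)` is at most `∏ v, c v`. -/
theorem abs_sum_prod_degree_le {V : Type*} [Fintype V] [DecidableEq V] (S : Finset V)
    (f : V → ℕ → ℝ) (c : V → ℝ) (hf : ∀ v ∉ S, ∀ d, f v d = 1) (hc1 : ∀ v ∉ S, 1 ≤ c v)
    (hc : ∀ v ∈ S, ∀ d < S.card,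
      |∑ k ∈ Finset.range (Sᶜ.card + 1), (Sᶜ.card.choose k : ℝ) * f v (d + k)| ≤
        c v * 2 ^ Sᶜ.card) :
    |∑ G : SimpleGraph V, ∏ v, f v (ndeg G v)| ≤ Fintype.card (SimpleGraph V) * ∏ v, c v := by
  classical
  let P : V → Finset (Finset V) := fun v => if v ∈ S then Sᶜ.powerset else {∅}
  have hP : ∀ T ∈ Fintype.piFinset P, ∀ a, T a ⊆ Sᶜ := by
    intro T hT a
    have := Fintype.mem_piFinset.1 hT a
    by_cases ha : a ∈ S
    · simpa [P, ha] using this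
    · simp only [P, ha, if_false, Finset.mem_singleton] at this
      simp [this]
  have hK : (0 : ℝ) < (Fintype.piFinset P).card := by
    rw [Fintype.card_piFinset]
    push_cast
    refine Finset.prod_pos fun v _ => ?_
    by_cases hv : v ∈ S <;> simp [P, hv]
  have key : ((Fintype.piFinset P).card : ℝ) * ∑ G : SimpleGraph V, ∏ v, f v (ndeg G v) =
      ∑ G : SimpleGraph V, ∏ v, ∑ T ∈ P v, f v (symmDiff (G.neighborFinset v) T).card := by
    simp_rw [Finset.prod_univ_sum]
    rw [Finset.sum_comm, ← nsmul_eq_mul, ← Finset.sum_const]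
    refine Finset.sum_congr rfl fun T hT => ?_
    have hinv : Function.Involutive fun G : SimpleGraph V => symmDiff G (starGraph T) :=
      fun G => symmDiff_symmDiff_cancel_right _ _
    rw [← Equiv.sum_comp hinv.toPerm]
    refine Finset.sum_congr rfl fun G _ => Finset.prod_congr rfl fun v _ => ?_
    by_cases hv : v ∈ S
    · rw [ndeg_eq_card]
      congr 2
      exact neighborFinset_symmDiff_starGraph G (hP T hT) hv
    · rw [hf v hv, hf v hv]
  have hb : ∀ G : SimpleGraph V,
      |∏ v, ∑ T ∈ P v, f v (symmDiff (G.neighborFinset v) T).card| ≤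
        (Fintype.piFinset P).card * ∏ v, c v := by
    intro G
    rw [Finset.abs_prod, Fintype.card_piFinset]
    push_cast
    rw [← Finset.prod_mul_distrib]
    refine Finset.prod_le_prod (fun _ _ => abs_nonneg _) fun v _ => ?_
    by_cases hv : v ∈ S
    · simp only [P, hv, if_true]
      rw [sum_powerset_card_symmDiff, Finset.card_powerset, mul_comm]
      push_cast
      refine hc v hv _ (Finset.card_lt_card ?_)
      refine Finset.ssubset_iff_subset_ne.2 ⟨Finset.inter_subset_right, fun h => ?_⟩
      rw [← h] at hv
      simp at hv
    · simpa [P, hv, hf v hv] using hc1 v hv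
  refine le_of_mul_le_mul_left ?_ hK
  calc ((Fintype.piFinset P).card : ℝ) * |∑ G : SimpleGraph V, ∏ v, f v (ndeg G v)|
      = |((Fintype.piFinset P).card : ℝ) * ∑ G : SimpleGraph V, ∏ v, f v (ndeg G v)| := by
        rw [abs_mul, abs_of_pos hK]
    _ ≤ ∑ G : SimpleGraph V, (Fintype.piFinset P).card * ∏ v, c v := by
        rw [key]
        exact (Finset.abs_sum_le_sum_abs _ _).trans (Finset.sum_le_sum fun G _ => hb G)
    _ = _ := by
        rw [Finset.sum_const, nsmul_eq_mul, Finset.card_univ]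
        ring

/-- A bound for the central moments of an indicator whose conditional mean is within a factor
`1 ± η` of `p`. -/
noncomputable def momentBound (p η : ℝ) (m : ℕ) : ℝ :=
  if m = 0 then 1 else if m = 1 then η * p else 3 * p

theorem momentBound_nonneg {p η : ℝ} (hp : 0 ≤ p) (hη : 0 ≤ η) (m : ℕ) :
    0 ≤ momentBound p η m := by
  unfold momentBound
  split_ifs <;> positivity

theorem sum_choose_mul_indicator_sub_pow (N d y m : ℕ) (hd : d ≤ y) (p : ℝ) :
    ∑ k ∈ Finset.range (N + 1), (N.choose k : ℝ) * ((if d + k = y then 1 else 0) - p) ^ m =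
      N.choose (y - d) * ((1 - p) ^ m - (-p) ^ m) + 2 ^ N * (-p) ^ m := by
  have h1 : ∀ k, (N.choose k : ℝ) * ((if d + k = y then 1 else 0) - p) ^ m =
      (if k = y - d then (N.choose k : ℝ) * ((1 - p) ^ m - (-p) ^ m) else 0) +
        N.choose k * (-p) ^ m := by
    intro k
    have : d + k = y ↔ k = y - d := by omega
    simp only [this]
    split_ifs
    · ring
    · simp
  simp_rw [h1]
  rw [Finset.sum_add_distrib, ← Finset.sum_mul, Finset.sum_ite_eq']
  congr 1
  · split_ifs with h
    · rfl
    · rw [Nat.choose_eq_zero_of_lt (by rw [Finset.mem_range] at h; omega)]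
      simp
  · congr 1
    exact_mod_cast Nat.sum_range_choose N

theorem abs_sum_choose_mul_indicator_sub_pow_le {N d y m : ℕ} (hm : m ≠ 0) (hd : d ≤ y) {p η : ℝ}
    (hp0 : 0 ≤ p) (hp1 : p ≤ 1) (hη : η ≤ 1)
    (h : |(N.choose (y - d) : ℝ) / 2 ^ N - p| ≤ η * p) :
    |∑ k ∈ Finset.range (N + 1), (N.choose k : ℝ) * ((if d + k = y then 1 else 0) - p) ^ m| ≤
      momentBound p η m * 2 ^ N := by
  rw [sum_choose_mul_indicator_sub_pow N d y m hd]
  have h2 : (0 : ℝ) < 2 ^ N := by positivity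
  set q : ℝ := (N.choose (y - d) : ℝ) / 2 ^ N with hq
  have hC : (N.choose (y - d) : ℝ) = q * 2 ^ N := by rw [hq]; field_simp
  have hq0 : 0 ≤ q := by positivity
  have hq1 : q ≤ 1 := by
    rw [hq, div_le_one h2]
    exact_mod_cast Nat.choose_le_two_pow _ _
  have e : (N.choose (y - d) : ℝ) * ((1 - p) ^ m - (-p) ^ m) + 2 ^ N * (-p) ^ m =
      (q * (1 - p) ^ m + (1 - q) * (-p) ^ m) * 2 ^ N := by rw [hC]; ring
  rw [e, abs_mul, abs_of_pos h2]
  refine mul_le_mul_of_nonneg_right ?_ h2.le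
  unfold momentBound
  rw [if_neg hm]
  split_ifs with h1
  · subst h1
    calc _ = |q - p| := by congr 1; ring
      _ ≤ _ := h
  · have hqp : q ≤ 2 * p := by
      have := (abs_le.1 h).2
      nlinarith
    have ha : |(1 - p) ^ m| ≤ 1 := by
      rw [abs_pow, abs_of_nonneg (by linarith)]
      exact pow_le_one₀ (by linarith) (by linarith)
    have hb : |(-p) ^ m| ≤ p := by
      rw [abs_pow, abs_neg, abs_of_nonneg hp0]
      exact pow_le_of_le_one hp0 hp1 hm
    calc |q * (1 - p) ^ m + (1 - q) * (-p) ^ m|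
        ≤ |q * (1 - p) ^ m| + |(1 - q) * (-p) ^ m| := abs_add_le _ _
      _ = q * |(1 - p) ^ m| + (1 - q) * |(-p) ^ m| := by
        rw [abs_mul, abs_mul, abs_of_nonneg hq0, abs_of_nonneg (by linarith : 0 ≤ 1 - q)]
      _ ≤ q * 1 + 1 * p := by gcongr; linarith
      _ ≤ 3 * p := by linarith

theorem sum_momentBound_mul_pow_div_factorial_le {p η l : ℝ} (hp : 0 ≤ p) (hη : 0 ≤ η)
    (hl0 : 0 ≤ l) (hl1 : l ≤ 1) (M : ℕ) :
    ∑ m ∈ Finset.range (M + 1), momentBound p η m * (l ^ m / m.factorial) ≤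
      Real.exp (l * p * η + 3 * p * l ^ 2) := by
  calc ∑ m ∈ Finset.range (M + 1), momentBound p η m * (l ^ m / m.factorial)
      ≤ ∑ m ∈ Finset.range (M + 2), momentBound p η m * (l ^ m / m.factorial) := by
        refine Finset.sum_le_sum_of_subset_of_nonneg
          (Finset.range_mono (by omega)) fun m _ _ => ?_
        exact mul_nonneg (momentBound_nonneg hp hη m) (by positivity)
    _ = 1 + η * p * l + 3 * p * ∑ m ∈ Finset.range M, l ^ (m + 2) / (m + 2).factorial := by
        rw [Finset.sum_range_succ', Finset.sum_range_succ', Finset.mul_sum]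
        simp [momentBound]
        ring
    _ ≤ 1 + η * p * l + 3 * p * l ^ 2 := by
        have h1 := Real.sum_le_exp_of_nonneg hl0 (M + 2)
        rw [Finset.sum_range_succ', Finset.sum_range_succ'] at h1
        have h2 := (abs_le.1 (Real.abs_exp_sub_one_sub_id_le (by rwa [abs_of_nonneg hl0]))).2
        simp only [zero_add, pow_one, Nat.factorial_one, Nat.cast_one, div_one, pow_zero,
          Nat.factorial_zero] at h1
        gcongr
        linarith
    _ ≤ _ := by
        have := Real.add_one_le_exp (l * p * η + 3 * p * l ^ 2)
        linarith

theorem sum_sub_pow_degree_le {n : ℕ} (y M : ℕ) {p η l : ℝ}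
    (hp0 : 0 ≤ p) (hp1 : p ≤ 1) (hη0 : 0 ≤ η) (hη1 : η ≤ 1) (hl0 : 0 < l) (hl1 : l ≤ 1)
    (H : ∀ s d, 1 ≤ s → s ≤ M → d < s →
      d ≤ y ∧ |((n - s).choose (y - d) : ℝ) / 2 ^ (n - s) - p| ≤ η * p) :
    ∑ G : SimpleGraph (Fin n), (∑ v, ((if ndeg G v = y then 1 else 0) - p)) ^ M ≤
      Fintype.card (SimpleGraph (Fin n)) *
        (M.factorial / l ^ M * Real.exp (n * (l * p * η + 3 * p * l ^ 2))) := by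
  simp_rw [Finset.sum_pow_eq_sum_piAntidiag]
  rw [Finset.sum_comm]
  have key : ∀ m ∈ Finset.piAntidiag (Finset.univ : Finset (Fin n)) M,
      ∑ G : SimpleGraph (Fin n), (Nat.multinomial Finset.univ m : ℝ) *
        ∏ v, ((if ndeg G v = y then (1 : ℝ) else 0) - p) ^ m v ≤
      Fintype.card (SimpleGraph (Fin n)) * (M.factorial / l ^ M *
        ∏ v, (momentBound p η (m v) * (l ^ m v / (m v).factorial))) := by
    intro m hm
    rw [Finset.mem_piAntidiag] at hm
    have hsum : ∑ v, m v = M := hm.1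
    let S : Finset (Fin n) := Finset.univ.filter fun v => m v ≠ 0
    have hS : S.card ≤ M := by
      rw [← hsum, Finset.card_eq_sum_ones]
      calc ∑ v ∈ S, 1 ≤ ∑ v ∈ S, m v := Finset.sum_le_sum fun v hv => by
            have := (Finset.mem_filter.1 hv).2
            omega
        _ ≤ ∑ v, m v := Finset.sum_le_univ_sum_of_nonneg fun _ => Nat.zero_le _
    have hcompl : Sᶜ.card = n - S.card := by rw [Finset.card_compl, Fintype.card_fin]
    have hmain := abs_sum_prod_degree_le S
      (fun v d => ((if d = y then (1 : ℝ) else 0) - p) ^ m v)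
      (fun v => momentBound p η (m v))
      (fun v hv d => by
        have : m v = 0 := by simpa [S] using hv
        simp [this])
      (fun v hv => by
        have : m v = 0 := by simpa [S] using hv
        simp [this, momentBound])
      (fun v hv d hd => by
        have hd' := H S.card d (by omega) hS hd
        rw [hcompl]
        exact abs_sum_choose_mul_indicator_sub_pow_le (Finset.mem_filter.1 hv).2 hd'.1 hp0 hp1 hη1
          hd'.2)
    rw [← Finset.mul_sum]
    have hspec : (∏ v, ((m v).factorial : ℝ)) * Nat.multinomial Finset.univ m = M.factorial := by
      have := Nat.multinomial_spec Finset.univ m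
      rw [hsum] at this
      exact_mod_cast this
    have hfac : (0 : ℝ) < ∏ v, ((m v).factorial : ℝ) :=
      Finset.prod_pos fun v _ => by positivity
    have hlp : ∏ v, l ^ m v = l ^ M := by rw [Finset.prod_pow_eq_pow_sum, hsum]
    calc _ ≤ (Nat.multinomial Finset.univ m : ℝ) *
          (Fintype.card (SimpleGraph (Fin n)) * ∏ v, momentBound p η (m v)) :=
          mul_le_mul_of_nonneg_left ((le_abs_self _).trans hmain) (by positivity)
      _ = _ := by
          rw [Finset.prod_mul_distrib, Finset.prod_div_distrib, hlp, ← hspec]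
          field_simp
  refine (Finset.sum_le_sum key).trans ?_
  rw [← Finset.mul_sum, ← Finset.mul_sum]
  gcongr
  calc ∑ m ∈ Finset.piAntidiag (Finset.univ : Finset (Fin n)) M,
        ∏ v, (momentBound p η (m v) * (l ^ m v / (m v).factorial))
      ≤ ∑ m ∈ Fintype.piFinset fun _ : Fin n => Finset.range (M + 1),
        ∏ v, (momentBound p η (m v) * (l ^ m v / (m v).factorial)) := by
        refine Finset.sum_le_sum_of_subset_of_nonneg ?_ fun m _ _ => ?_
        · intro m hm
          rw [Finset.mem_piAntidiag] at hm
          rw [Fintype.mem_piFinset]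
          intro v
          rw [Finset.mem_range, Nat.lt_succ_iff, ← hm.1]
          exact Finset.single_le_sum (fun _ _ => Nat.zero_le _) (Finset.mem_univ v)
        · exact Finset.prod_nonneg fun v _ =>
            mul_nonneg (momentBound_nonneg hp0 hη0 _) (by positivity)
    _ = ∏ v : Fin n, ∑ m ∈ Finset.range (M + 1),
          momentBound p η m * (l ^ m / m.factorial) := by
        rw [Finset.prod_univ_sum]
    _ ≤ ∏ v : Fin n, Real.exp (l * p * η + 3 * p * l ^ 2) := by
        refine Finset.prod_le_prod (fun v _ => Finset.sum_nonneg fun m _ =>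
            mul_nonneg (momentBound_nonneg hp0 hη0 _) (by positivity)) fun v _ => ?_
        exact sum_momentBound_mul_pow_div_factorial_le hp0 hη0 hl0.le hl1 M
    _ = _ := by
        rw [Finset.prod_const, ← Real.exp_nat_mul, Finset.card_univ, Fintype.card_fin]

theorem gprob_eq {V : Type*} [Finite V] (A : Set (SimpleGraph V)) :
    gprob A = (A.ncard : ℝ) / Nat.card (SimpleGraph V) := by
  rw [gprob, card_simpleGraph, Nat.card_coe_set_eq]
  push_cast
  rfl

theorem gprob_le_of_subset_biUnion {V ι : Type*} [Finite V] (A : Set (SimpleGraph V))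
    (s : Finset ι) (B : ι → Set (SimpleGraph V)) (b : ℝ) (hA : Aᶜ ⊆ ⋃ i ∈ s, B i)
    (hB : ∀ i ∈ s, gprob (B i) ≤ b) : 1 - s.card * b ≤ gprob A ∧ gprob A ≤ 1 := by
  have hc : (0 : ℝ) < Nat.card (SimpleGraph V) := by
    rw [card_simpleGraph]
    positivity
  have h0 : (A.ncard : ℝ) + Aᶜ.ncard = Nat.card (SimpleGraph V) := by
    exact_mod_cast Set.ncard_add_ncard_compl A
  have h1 : (Aᶜ.ncard : ℝ) ≤ ∑ i ∈ s, ((B i).ncard : ℝ) := by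
    exact_mod_cast (Set.ncard_le_ncard hA (Set.toFinite _)).trans (Finset.set_ncard_biUnion_le s B)
  have h2 : ∑ i ∈ s, ((B i).ncard : ℝ) ≤ s.card * b * Nat.card (SimpleGraph V) := by
    rw [mul_assoc, ← nsmul_eq_mul, ← Finset.sum_const]
    refine Finset.sum_le_sum fun i hi => ?_
    have := hB i hi
    rwa [gprob_eq, div_le_iff₀ hc] at this
  rw [gprob_eq]
  refine ⟨?_, ?_⟩
  · rw [le_div_iff₀ hc]
    linarith
  · rw [div_le_one hc, ← h0]
    have : (0 : ℝ) ≤ Aᶜ.ncard := by positivity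
    linarith

theorem Ncount_natCast {n : ℕ} (G : SimpleGraph (Fin n)) (y : ℕ) :
    (Ncount G y : ℝ) = ∑ v, if ndeg G v = y then (1 : ℝ) else 0 := by
  rw [Finset.sum_boole, Ncount, ← Set.ncard_coe_finset]
  congr 2
  ext v
  simp

/-- Concentration of `N_y` by the method of high moments. -/
theorem gprob_abs_Ncount_sub_ge_le {n : ℕ} (y r : ℕ) {p η l t : ℝ}
    (hp0 : 0 ≤ p) (hp1 : p ≤ 1) (hη0 : 0 ≤ η) (hη1 : η ≤ 1) (hl0 : 0 < l) (hl1 : l ≤ 1)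
    (ht : 0 < t)
    (H : ∀ s d, 1 ≤ s → s ≤ 2 * r → d < s →
      d ≤ y ∧ |((n - s).choose (y - d) : ℝ) / 2 ^ (n - s) - p| ≤ η * p) :
    gprob {G : SimpleGraph (Fin n) | t ≤ |(Ncount G y : ℝ) - n * p|} ≤
      (2 * r).factorial / (l * t) ^ (2 * r) * Real.exp (n * (l * p * η + 3 * p * l ^ 2)) := by
  classical
  have hmom := sum_sub_pow_degree_le y (2 * r) hp0 hp1 hη0 hη1 hl0 hl1 H
  have hc : (0 : ℝ) < Fintype.card (SimpleGraph (Fin n)) := by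
    exact_mod_cast Fintype.card_pos
  have hZ : ∀ G : SimpleGraph (Fin n),
      ∑ v, ((if ndeg G v = y then (1 : ℝ) else 0) - p) = Ncount G y - n * p := by
    intro G
    rw [Finset.sum_sub_distrib, Ncount_natCast]
    simp
  simp_rw [hZ] at hmom
  rw [gprob_eq, Nat.card_eq_fintype_card, div_le_iff₀ hc]
  set A : Set (SimpleGraph (Fin n)) := {G | t ≤ |(Ncount G y : ℝ) - n * p|} with hA
  have hmarkov : (A.ncard : ℝ) * t ^ (2 * r) ≤
      ∑ G : SimpleGraph (Fin n), ((Ncount G y : ℝ) - n * p) ^ (2 * r) := by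
    rw [Set.ncard_eq_toFinset_card', ← nsmul_eq_mul, ← Finset.sum_const]
    refine (Finset.sum_le_sum fun G hG => ?_).trans
      (Finset.sum_le_univ_sum_of_nonneg fun G => (even_two_mul r).pow_nonneg _)
    have hG' : t ≤ |(Ncount G y : ℝ) - n * p| := by simpa [hA] using hG
    rw [← (even_two_mul r).pow_abs ((Ncount G y : ℝ) - n * p)]
    gcongr
  have ht' : 0 < t ^ (2 * r) := by positivity
  refine le_of_mul_le_mul_right ?_ ht'
  refine (hmarkov.trans hmom).trans (le_of_eq ?_)
  rw [mul_pow]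
  field_simp

/-- The probability that a binomial variable with parameters `N` and `1/2` takes the value `x`. -/
noncomputable def binHalf (N x : ℕ) : ℝ := (N.choose x : ℝ) / 2 ^ N

theorem binHalf_nonneg (N x : ℕ) : 0 ≤ binHalf N x := by
  unfold binHalf
  positivity

theorem binHalf_le_one (N x : ℕ) : binHalf N x ≤ 1 := by
  rw [binHalf, div_le_one (by positivity)]
  exact_mod_cast Nat.choose_le_two_pow _ _

theorem binHalf_eq_mul_left {N x : ℕ} (h : x ≤ N + 1) :
    binHalf N x = binHalf (N + 1) x * (2 * (N + 1 - x) / (N + 1)) := by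
  have h1 := congrArg (Nat.cast : ℕ → ℝ) (Nat.choose_mul_succ_eq N x)
  push_cast [Nat.cast_sub h] at h1
  have : (N : ℝ) + 1 ≠ 0 := by positivity
  unfold binHalf
  rw [pow_succ]
  field_simp
  linarith

theorem binHalf_eq_mul_right (N x : ℕ) :
    binHalf N x = binHalf (N + 1) (x + 1) * (2 * (x + 1) / (N + 1)) := by
  have h1 := congrArg (Nat.cast : ℕ → ℝ) (Nat.add_one_mul_choose_eq N x)
  push_cast at h1
  have : (N : ℝ) + 1 ≠ 0 := by positivity
  unfold binHalf
  rw [pow_succ]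
  field_simp
  linarith

theorem abs_sub_le_of_abs_sub_le_mul {a b c β γ : ℝ}
    (hβ : 0 ≤ β) (h1 : |a - b| ≤ β * b) (h2 : |b - c| ≤ (γ - 1) * c) :
    |a - c| ≤ (γ * (1 + β) - 1) * c := by
  have h3 : b ≤ γ * c := by linarith [(abs_le.1 h2).2]
  calc |a - c| ≤ |a - b| + |b - c| := abs_sub_le _ _ _
    _ ≤ β * (γ * c) + (γ - 1) * c := by gcongr; exact h1.trans (by gcongr)
    _ = _ := by ring

theorem abs_binHalf_sub_le_pow {β : ℝ} (hβ : 0 ≤ β) (j : ℕ) : ∀ d ≤ j, ∀ N x : ℕ,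
    |2 * ((x : ℝ) + d) - (N + j)| + j ≤ β * N → x ≤ N →
    |binHalf N x - binHalf (N + j) (x + d)| ≤ ((1 + β) ^ j - 1) * binHalf (N + j) (x + d) := by
  induction j with
  | zero =>
    intro d hd N x _ _
    obtain rfl : d = 0 := by omega
    simp
  | succ j ih =>
    intro d hd N x h hx
    have hN : (0 : ℝ) < N + 1 := by positivity
    push_cast at h
    have hdj : (d : ℝ) ≤ j + 1 := by exact_mod_cast hd
    have hd0 : (0 : ℝ) ≤ d := by positivity
    obtain ⟨h1, h2⟩ := abs_le.1 (le_sub_iff_add_le.2 h)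
    have hβN : β * (N + 1) = β * N + β := by ring
    obtain rfl | ⟨d, rfl⟩ : d = 0 ∨ ∃ e, d = e + 1 := by
      cases d with
      | zero => simp
      | succ e => exact Or.inr ⟨e, rfl⟩
    · rw [Nat.cast_zero] at h1 h2
      have e1 := binHalf_eq_mul_left (by omega : x ≤ N + 1)
      have := ih 0 (Nat.zero_le _) (N + 1) x (by
        push_cast at h ⊢
        rw [← le_sub_iff_add_le, abs_le]
        constructor <;> linarith) (by omega)
      have e2 : N + 1 + j = N + (j + 1) := by ring
      rw [e2] at this
      rw [pow_succ]
      refine abs_sub_le_of_abs_sub_le_mul hβ ?_ this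
      rw [e1]
      have e3 : binHalf (N + 1) x * (2 * (N + 1 - x) / (N + 1)) - binHalf (N + 1) x =
        ((N + 1 - 2 * x) / (N + 1)) * binHalf (N + 1) x := by field_simp; ring
      rw [e3, abs_mul, abs_of_nonneg (binHalf_nonneg _ _)]
      refine mul_le_mul_of_nonneg_right ?_ (binHalf_nonneg _ _)
      rw [abs_div, abs_of_pos hN, div_le_iff₀ hN, abs_le]
      constructor <;> linarith
    · have e1 := binHalf_eq_mul_right N x
      have := ih d (by omega) (N + 1) (x + 1) (by
        push_cast at h1 h2 ⊢
        rw [← le_sub_iff_add_le, abs_le]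
        constructor <;> linarith) (by omega)
      have e2 : N + 1 + j = N + (j + 1) := by ring
      have e4 : x + 1 + d = x + (d + 1) := by ring
      rw [e2, e4] at this
      rw [pow_succ]
      refine abs_sub_le_of_abs_sub_le_mul hβ ?_ this
      rw [e1]
      have e3 : binHalf (N + 1) (x + 1) * (2 * (x + 1) / (N + 1)) - binHalf (N + 1) (x + 1) =
        ((2 * x + 1 - N) / (N + 1)) * binHalf (N + 1) (x + 1) := by field_simp; ring
      rw [e3, abs_mul, abs_of_nonneg (binHalf_nonneg _ _)]
      refine mul_le_mul_of_nonneg_right ?_ (binHalf_nonneg _ _)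
      rw [abs_div, abs_of_pos hN, div_le_iff₀ hN, abs_le]
      push_cast at h1 h2 hdj
      constructor <;> linarith

theorem one_add_pow_sub_one_le {β : ℝ} (hβ : 0 ≤ β) {j : ℕ} (h : j * β ≤ 1) :
    (1 + β) ^ j - 1 ≤ 2 * (j * β) := by
  have h0 : 0 ≤ j * β := by positivity
  have h1 : (1 + β) ^ j ≤ Real.exp (j * β) := by
    rw [Real.exp_nat_mul]
    gcongr
    linarith [Real.add_one_le_exp β]
  have h2 := (abs_le.1 (Real.abs_exp_sub_one_le (by rwa [abs_of_nonneg h0]))).2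
  rw [abs_of_nonneg h0] at h2
  linarith

theorem abs_binHalf_succ_sub_le {N x : ℕ} (h : x ≤ N) :
    |binHalf N (x + 1) - binHalf N x| = |(N : ℝ) - 1 - 2 * x| / (x + 1) * binHalf N x := by
  have h1 := congrArg (Nat.cast : ℕ → ℝ) (Nat.choose_succ_right_eq N x)
  push_cast [Nat.cast_sub h] at h1
  have h2 : (0 : ℝ) < x + 1 := by positivity
  have : binHalf N (x + 1) - binHalf N x = (N - 1 - 2 * x) / (x + 1) * binHalf N x := by
    unfold binHalf
    field_simp
    linarith
  rw [this, abs_mul, abs_div, abs_of_pos h2, abs_of_nonneg (binHalf_nonneg _ _)]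

theorem log_le_half_sub_inv {t : ℝ} (ht : 1 ≤ t) : Real.log t ≤ (t - t⁻¹) / 2 := by
  have h0 : 0 < t := by linarith
  have := Real.self_le_sinh_iff.2 (Real.log_nonneg ht)
  rwa [Real.sinh_log h0] at this

theorem entropy_le_of_nonneg {δ : ℝ} (h0 : 0 ≤ δ) (h1 : δ ≤ 1 / 2) :
    (1 + δ) * Real.log (1 + δ) + (1 - δ) * Real.log (1 - δ) ≤ δ ^ 2 + 4 * δ ^ 4 := by
  have hp : 0 < 1 + δ := by linarith
  have hm : 0 < 1 - δ := by linarith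
  have e1 : Real.log (1 + δ) + Real.log (1 - δ) ≤ -δ ^ 2 := by
    rw [← Real.log_mul hp.ne' hm.ne']
    have := Real.log_le_sub_one_of_pos (mul_pos hp hm)
    nlinarith
  have e2 : Real.log (1 + δ) - Real.log (1 - δ) ≤ 2 * δ + 8 / 3 * δ ^ 3 := by
    rw [← Real.log_div hp.ne' hm.ne']
    refine (log_le_half_sub_inv ((one_le_div hm).2 (by linarith))).trans ?_
    rw [inv_div]
    have : ((1 + δ) / (1 - δ) - (1 - δ) / (1 + δ)) / 2 = 2 * δ / (1 - δ ^ 2) := by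
      have : 1 - δ ^ 2 = (1 - δ) * (1 + δ) := by ring
      rw [this]
      field_simp
      ring
    rw [this, div_le_iff₀ (by nlinarith)]
    have h3 : 0 ≤ δ ^ 3 := by positivity
    have h4 : δ ^ 2 ≤ 1 / 4 := by nlinarith
    nlinarith [mul_le_mul_of_nonneg_left h4 h3]
  nlinarith [mul_le_mul_of_nonneg_left e2 h0, sq_nonneg (δ ^ 2)]

theorem entropy_le {δ : ℝ} (h : |δ| ≤ 1 / 2) :
    (1 + δ) * Real.log (1 + δ) + (1 - δ) * Real.log (1 - δ) ≤ δ ^ 2 + 4 * δ ^ 4 := by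
  rcases le_total 0 δ with h0 | h0
  · exact entropy_le_of_nonneg h0 (by rwa [abs_of_nonneg h0] at h)
  · have := entropy_le_of_nonneg (δ := -δ) (by linarith) (by rwa [abs_of_nonpos h0] at h)
    have e : (-δ) ^ 4 = δ ^ 4 := by ring
    simp only [sub_neg_eq_add, neg_sq, e] at this
    rw [← sub_eq_add_neg] at this
    linarith

theorem log_factorial_le_of_stirlingSeq_le {x : ℕ} (hx : x ≠ 0) {c : ℝ} (hc : 0 < c)
    (h : Stirling.stirlingSeq x ≤ c * √Real.pi) :
    Real.log x.factorial ≤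
      Real.log c + (Real.log (2 * Real.pi) + Real.log x) / 2 + x * Real.log x - x := by
  have hx' : (0 : ℝ) < x := by positivity
  have h1 := Stirling.log_stirlingSeq_formula x
  have h2 : Real.log (Stirling.stirlingSeq x) ≤ Real.log (c * √Real.pi) := by
    refine Real.log_le_log ?_ h
    obtain ⟨m, rfl⟩ := Nat.exists_eq_succ_of_ne_zero hx
    exact Stirling.stirlingSeq'_pos m
  rw [Real.log_mul hc.ne' (by positivity), Real.log_sqrt Real.pi_pos.le] at h2
  rw [Real.log_mul two_ne_zero hx'.ne', Real.log_div hx'.ne' (Real.exp_pos 1).ne',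
    Real.log_exp] at h1
  rw [Real.log_mul two_ne_zero Real.pi_pos.ne']
  linarith

/-- A sharp local lower bound for symmetric binomial probabilities. -/
theorem le_log_binHalf {N x : ℕ} (hx : x ≠ 0) (hxN : x < N) {c : ℝ} (hc : 0 < c)
    (h1 : Stirling.stirlingSeq x ≤ c * √Real.pi)
    (h2 : Stirling.stirlingSeq (N - x) ≤ c * √Real.pi) (hD : |2 * (x : ℝ) - N| ≤ N / 2) :
    -2 * Real.log c + (2 * Real.log 2 - Real.log (2 * Real.pi) - Real.log N) / 2
      - (2 * (x : ℝ) - N) ^ 2 / (2 * N) - 2 * (2 * (x : ℝ) - N) ^ 4 / N ^ 3 ≤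
      Real.log (binHalf N x) := by
  have hz : N - x ≠ 0 := by omega
  have hN0 : N ≠ 0 := by omega
  have hN : (0 : ℝ) < N := by positivity
  have hx' : (0 : ℝ) < x := by positivity
  have hz' : (0 : ℝ) < (N : ℝ) - x := by
    have : (x : ℝ) < N := by exact_mod_cast hxN
    linarith
  have hzc : ((N - x : ℕ) : ℝ) = N - x := Nat.cast_sub hxN.le
  have f1 := log_factorial_le_of_stirlingSeq_le hx hc h1
  have f2 := log_factorial_le_of_stirlingSeq_le hz hc h2
  have f3 := Stirling.le_log_factorial_stirling hN0
  rw [hzc] at f2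
  have hch : Real.log (N.choose x) =
      Real.log N.factorial - Real.log x.factorial - Real.log (N - x).factorial := by
    have : (N.factorial : ℝ) = N.choose x * x.factorial * (N - x).factorial := by
      exact_mod_cast (Nat.choose_mul_factorial_mul_factorial hxN.le).symm
    have hp : (0 : ℝ) < N.choose x := by exact_mod_cast Nat.choose_pos hxN.le
    rw [this, Real.log_mul (by positivity) (by positivity),
      Real.log_mul (by positivity) (by positivity)]
    ring
  have hbin : Real.log (binHalf N x) = Real.log (N.choose x) - N * Real.log 2 := by
    have hp : (0 : ℝ) < N.choose x := by exact_mod_cast Nat.choose_pos hxN.le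
    rw [binHalf, Real.log_div hp.ne' (by positivity), Real.log_pow]
  have hprod : Real.log x + Real.log ((N : ℝ) - x) ≤ 2 * Real.log N - 2 * Real.log 2 := by
    rw [← Real.log_mul hx'.ne' hz'.ne', ← mul_sub, ← Real.log_div hN.ne' two_ne_zero]
    have : 2 * Real.log ((N : ℝ) / 2) = Real.log (((N : ℝ) / 2) ^ 2) := by
      rw [Real.log_pow]
      norm_num
    rw [this]
    refine Real.log_le_log (by positivity) ?_
    nlinarith [sq_nonneg ((N : ℝ) - 2 * x)]
  set δ : ℝ := (2 * (x : ℝ) - N) / N with hδ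
  have hδx : (x : ℝ) = N / 2 * (1 + δ) := by rw [hδ]; field_simp; ring
  have hδz : (N : ℝ) - x = N / 2 * (1 - δ) := by rw [hδ]; field_simp; ring
  have hδ1 : 0 < 1 + δ := by
    have := hδx ▸ hx'
    exact pos_of_mul_pos_right this (by positivity)
  have hδ2 : 0 < 1 - δ := by
    have := hδz ▸ hz'
    exact pos_of_mul_pos_right this (by positivity)
  have hent := entropy_le (δ := δ) (by
    rw [hδ, abs_div, abs_of_pos hN, div_le_iff₀ hN]
    linarith)
  have hl1 : Real.log x = Real.log N - Real.log 2 + Real.log (1 + δ) := by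
    rw [← Real.log_div hN.ne' two_ne_zero, ← Real.log_mul (by positivity) hδ1.ne', ← hδx]
  have hl2 : Real.log ((N : ℝ) - x) = Real.log N - Real.log 2 + Real.log (1 - δ) := by
    rw [← Real.log_div hN.ne' two_ne_zero, ← Real.log_mul (by positivity) hδ2.ne', ← hδz]
  have hsum : x * Real.log x + (N - x) * Real.log ((N : ℝ) - x) ≤
      N * Real.log N - N * Real.log 2 + N / 2 * (δ ^ 2 + 4 * δ ^ 4) := by
    have : x * Real.log x + (N - x) * Real.log ((N : ℝ) - x) = N * Real.log N - N * Real.log 2 +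
        N / 2 * ((1 + δ) * Real.log (1 + δ) + (1 - δ) * Real.log (1 - δ)) := by
      rw [hl1, hl2]
      linear_combination Real.log (1 + δ) * hδx + Real.log (1 - δ) * hδz
    rw [this]
    gcongr
  have hδ' : N / 2 * (δ ^ 2 + 4 * δ ^ 4) =
      (2 * (x : ℝ) - N) ^ 2 / (2 * N) + 2 * (2 * (x : ℝ) - N) ^ 4 / N ^ 3 := by
    rw [hδ]
    field_simp
    ring
  rw [hbin, hch]
  linarith

theorem eventually_log_bounds : ∀ᶠ n : ℕ in atTop, 10 ^ 6 ≤ Real.log n ∧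
    10 ^ 6 * Real.log (Real.log n) ^ 2 ≤ Real.log n ^ ((1 : ℝ) / 4) ∧ Real.log n ^ 8 ≤ n := by
  have hcast : Tendsto (fun n : ℕ => (n : ℝ)) atTop atTop := tendsto_natCast_atTop_atTop
  have hlog : Tendsto (fun n : ℕ => Real.log n) atTop atTop := Real.tendsto_log_atTop.comp hcast
  have h1 := hlog.eventually_ge_atTop (10 ^ 6)
  have h2 := hlog.eventually ((isLittleO_log_rpow_atTop (r := 1 / 8) (by norm_num)).bound
    (show (0 : ℝ) < 1 / 10 ^ 3 by norm_num))
  have h3 := hcast.eventually ((isLittleO_log_rpow_atTop (r := 1 / 8) (by norm_num)).bound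
    (show (0 : ℝ) < 1 by norm_num))
  filter_upwards [h1, h2, h3] with n h1 h2 h3
  have hL : (0 : ℝ) ≤ Real.log n := by linarith
  refine ⟨h1, ?_, ?_⟩
  · rw [Real.norm_eq_abs, Real.norm_eq_abs, abs_of_nonneg (Real.rpow_nonneg hL (1 / 8))] at h2
    have : Real.log n ^ ((1 : ℝ) / 4) = (Real.log n ^ ((1 : ℝ) / 8)) ^ 2 := by
      rw [← Real.rpow_natCast, ← Real.rpow_mul hL]
      norm_num
    rw [this, ← sq_abs (Real.log (Real.log n))]
    nlinarith [abs_nonneg (Real.log (Real.log n))]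
  · have hn : (0 : ℝ) ≤ n := Nat.cast_nonneg n
    rw [Real.norm_eq_abs, Real.norm_eq_abs, abs_of_nonneg hL,
      abs_of_nonneg (Real.rpow_nonneg hn (1 / 8)), one_mul] at h3
    calc Real.log n ^ 8 ≤ ((n : ℝ) ^ ((1 : ℝ) / 8)) ^ 8 := by gcongr
      _ = (n : ℝ) := by
        rw [← Real.rpow_natCast, ← Real.rpow_mul hn]
        norm_num

/-- The width of the range of frequent degrees. -/
noncomputable def degreeWidth (n : ℕ) : ℝ := √((n : ℝ) * Real.log n * (1 - zeta2 n))

theorem degreeWidth_bounds {n : ℕ} (h1 : 10 ^ 6 ≤ Real.log n)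
    (h2 : 10 ^ 6 * Real.log (Real.log n) ^ 2 ≤ Real.log n ^ ((1 : ℝ) / 4))
    (h3 : Real.log n ^ 8 ≤ n) :
    1 ≤ Real.log (Real.log n) ∧ Real.log (Real.log n) ≤ Real.log n ∧
    degreeWidth n ^ 2 =
      n * (Real.log n - Real.log (2 * Real.pi) - 5 / 2 * Real.log (Real.log n)) ∧
    degreeWidth n ^ 2 ≤ n * Real.log n ∧ degreeWidth n ≤ n / Real.log n ^ 3 := by
  set L := Real.log n with hL
  set l := Real.log L with hl
  have hL0 : 0 < L := by linarith
  have hn : (0 : ℝ) ≤ n := Nat.cast_nonneg n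
  have hl1 : 1 ≤ l := by
    rw [hl, Real.le_log_iff_exp_le hL0]
    linarith [Real.exp_one_lt_d9]
  have h2' : 10 ^ 6 * l ≤ L := by
    have : L ^ ((1 : ℝ) / 4) ≤ L := by
      conv_rhs => rw [← Real.rpow_one L]
      exact Real.rpow_le_rpow_of_exponent_le (by linarith) (by norm_num)
    nlinarith
  have hpi0 : 0 ≤ Real.log (2 * Real.pi) := Real.log_nonneg (by linarith [Real.pi_gt_three])
  have hpi1 : Real.log (2 * Real.pi) ≤ 7 := by
    have := Real.log_le_sub_one_of_pos (show 0 < 2 * Real.pi by positivity)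
    linarith [Real.pi_lt_four]
  have hQ : L * (1 - zeta2 n) = L - Real.log (2 * Real.pi) - 5 / 2 * l := by
    rw [zeta2, ← hL, ← hl]
    field_simp
    ring
  have hsq : degreeWidth n ^ 2 = n * (L - Real.log (2 * Real.pi) - 5 / 2 * l) := by
    rw [degreeWidth, mul_assoc, ← hL, hQ, Real.sq_sqrt]
    exact mul_nonneg hn (by linarith)
  have hsq' : degreeWidth n ^ 2 ≤ n * L := by
    rw [hsq]
    gcongr
    linarith
  refine ⟨hl1, by linarith, hsq, hsq', ?_⟩
  refine abs_le_of_sq_le_sq' ?_ (by positivity) |>.2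
  refine hsq'.trans ?_
  rw [div_pow, le_div_iff₀ (by positivity)]
  have : L ^ 7 ≤ n := (pow_le_pow_right₀ (by linarith) (by norm_num)).trans h3
  nlinarith

/-- The asymptotic estimate for the expected number of vertices of a frequent degree. -/
theorem eventually_le_mul_binHalf : ∀ᶠ n : ℕ in atTop, ∀ y : ℕ,
    |2 * (y : ℝ) - n| ≤ degreeWidth n + 4 →
      3 / 2 * Real.log n ^ ((5 : ℝ) / 4) ≤ n * binHalf (n - 1) y := by
  have hst : ∀ᶠ x in atTop, Stirling.stirlingSeq x ≤ 11 / 10 * √Real.pi := by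
    refine (Stirling.tendsto_stirlingSeq_sqrt_pi.eventually_lt_const ?_).mono fun _ h => h.le
    have : 0 < √Real.pi := Real.sqrt_pos.2 Real.pi_pos
    linarith
  obtain ⟨K, hK⟩ := eventually_atTop.1 hst
  filter_upwards [eventually_log_bounds, eventually_ge_atTop (4 * K + 100)] with n hn hnK y hy
  obtain ⟨h1, h2, h3⟩ := hn
  obtain ⟨hl1, hlL, hsq, hsq', hR⟩ := degreeWidth_bounds h1 h2 h3
  have hR0 : 0 ≤ degreeWidth n := Real.sqrt_nonneg _
  set R := degreeWidth n
  set L := Real.log n with hL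
  set l := Real.log L with hl
  have hL0 : 0 < L := by linarith
  obtain ⟨N, rfl⟩ : ∃ N, n = N + 1 := ⟨n - 1, by omega⟩
  rw [Nat.add_sub_cancel]
  have hnL : 10 ^ 6 * L ^ 2 ≤ ((N + 1 : ℕ) : ℝ) := by
    have : 10 ^ 6 * L ^ 2 ≤ L ^ 8 := by
      have : (10 : ℝ) ^ 6 ≤ L ^ 6 := by
        refine h1.trans ?_
        exact le_self_pow₀ (by linarith) (by norm_num)
      calc 10 ^ 6 * L ^ 2 ≤ L ^ 6 * L ^ 2 := by gcongr
        _ = L ^ 8 := by ring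
    linarith
  have hnLR : 10 ^ 6 * R ≤ ((N + 1 : ℕ) : ℝ) := by
    rw [le_div_iff₀ (by positivity)] at hR
    have : (10 : ℝ) ^ 6 ≤ L ^ 3 := h1.trans (le_self_pow₀ (by linarith) (by norm_num))
    nlinarith
  have hLL : 10 ^ 6 * L ≤ L ^ 2 := by nlinarith
  push_cast at *
  have hN : (0 : ℝ) < N := by
    have : 100 ≤ N + 1 := by omega
    have : (100 : ℝ) ≤ N + 1 := by exact_mod_cast this
    linarith
  obtain ⟨hy1, hy2⟩ := abs_le.1 hy
  have hyN : 4 * y ≥ N ∧ y < N ∧ 4 * (N - y) ≥ N := by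
    have a1 : (N : ℝ) ≤ 4 * y := by linarith
    have a2 : 4 * (y : ℝ) ≤ 3 * N := by linarith
    have a1' : N ≤ 4 * y := by exact_mod_cast a1
    have a2' : 4 * y ≤ 3 * N := by exact_mod_cast a2
    omega
  have hD : |2 * (y : ℝ) - N| ≤ R + 5 := by
    rw [abs_le]
    constructor <;> linarith
  have hmain := le_log_binHalf (N := N) (x := y) (by omega) hyN.2.1
    (show (0 : ℝ) < 11 / 10 by norm_num) (hK _ (by omega)) (hK _ (by omega))
    (hD.trans (by linarith))
  have hc : Real.log (11 / 10) ≤ 1 / 10 := by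
    have := Real.log_le_sub_one_of_pos (show (0 : ℝ) < 11 / 10 by norm_num)
    linarith
  have hD2 : (2 * (y : ℝ) - N) ^ 2 ≤ (R + 5) ^ 2 := sq_le_sq' (abs_le.1 hD).1 (abs_le.1 hD).2
  have hpi0 : 0 ≤ Real.log (2 * Real.pi) := Real.log_nonneg (by linarith [Real.pi_gt_three])
  set Q := L - Real.log (2 * Real.pi) - 5 / 2 * l with hQ
  have hQL : Q ≤ L := by linarith
  have hD3 : (2 * (y : ℝ) - N) ^ 2 ≤ N * (Q + 1 / 50) := by nlinarith
  have e1 : (2 * (y : ℝ) - N) ^ 2 / (2 * N) ≤ Q / 2 + 1 / 100 := by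
    rw [div_le_iff₀ (by positivity)]
    linarith
  have hD4 : (2 * (y : ℝ) - N) ^ 4 ≤ N ^ 2 * (2 * L) ^ 2 := by
    have : (2 * (y : ℝ) - N) ^ 2 ≤ N * (2 * L) := hD3.trans (by gcongr; linarith)
    calc (2 * (y : ℝ) - N) ^ 4 = ((2 * (y : ℝ) - N) ^ 2) ^ 2 := by ring
      _ ≤ (N * (2 * L)) ^ 2 := by gcongr
      _ = _ := by ring
  have e2 : 2 * (2 * (y : ℝ) - N) ^ 4 / N ^ 3 ≤ 1 / 100 := by
    rw [div_le_iff₀ (by positivity)]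
    calc 2 * (2 * (y : ℝ) - N) ^ 4 ≤ (N : ℝ) ^ 2 * (8 * L ^ 2) := by linarith
      _ ≤ (N : ℝ) ^ 2 * (1 / 100 * (N : ℝ)) :=
        mul_le_mul_of_nonneg_left (by linarith) (by positivity)
      _ = 1 / 100 * (N : ℝ) ^ 3 := by ring
  have hlogN : Real.log N ≤ L := by
    rw [hL]
    exact Real.log_le_log hN (by linarith)
  have h43 : 1 / 4 ≤ Real.log 2 - Real.log (3 / 2) := by
    rw [← Real.log_div (by norm_num) (by norm_num)]
    have := Real.one_sub_inv_le_log_of_pos (show (0 : ℝ) < 2 / (3 / 2) by norm_num)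
    norm_num at this ⊢
    linarith
  have hp : 0 < binHalf N y := by
    unfold binHalf
    have : 0 < N.choose y := Nat.choose_pos (by omega)
    positivity
  rw [← Real.log_le_log_iff (by positivity) (by positivity),
    Real.log_mul (by positivity) hp.ne', Real.log_mul (by norm_num) (by positivity),
    Real.log_rpow hL0, ← hL, ← hl]
  linarith

theorem eventually_abs_binHalf_sub_le : ∀ᶠ n : ℕ in atTop, ∀ y : ℕ,
    |2 * (y : ℝ) - n| ≤ degreeWidth n + 4 → ∀ s d : ℕ, 1 ≤ s → s ≤ 2 * ⌈2 * Real.log n⌉₊ → d < s →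
      d ≤ y ∧ |binHalf (n - s) (y - d) - binHalf (n - 1) y| ≤
        1 / (96 * Real.log (Real.log n)) * binHalf (n - 1) y := by
  filter_upwards [eventually_log_bounds] with n hn y hy s d hs1 hs2 hds
  obtain ⟨h1, h2, h3⟩ := hn
  obtain ⟨hl1, hlL, -, -, hR⟩ := degreeWidth_bounds h1 h2 h3
  set R := degreeWidth n
  set L := Real.log n with hL
  set l := Real.log L with hl
  have hL0 : 0 < L := by linarith
  have hs : (s : ℝ) ≤ 6 * L := by
    have := Nat.ceil_lt_add_one (show 0 ≤ 2 * L by positivity)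
    have h : (s : ℝ) ≤ 2 * ⌈2 * L⌉₊ := by exact_mod_cast hs2
    linarith
  have hd : (d : ℝ) ≤ s := by exact_mod_cast hds.le
  have hL3 : (10 : ℝ) ^ 6 ≤ L ^ 3 := h1.trans (le_self_pow₀ (by linarith) (by norm_num))
  have hB : 10 ^ 6 * L ≤ n / L ^ 3 := by
    rw [le_div_iff₀ (by positivity)]
    calc 10 ^ 6 * L * L ^ 3 ≤ L ^ 3 * L * L ^ 3 := by gcongr
      _ = L ^ 7 := by ring
      _ ≤ L ^ 8 := pow_le_pow_right₀ (by linarith) (by norm_num)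
      _ ≤ n := h3
  have hBn : 10 ^ 6 * (n / L ^ 3) ≤ n := by
    rw [← mul_div_assoc, div_le_iff₀ (by positivity)]
    nlinarith
  set B := (n : ℝ) / L ^ 3 with hBdef
  obtain ⟨hy1, hy2⟩ := abs_le.1 hy
  have hdy : d ≤ y := by
    have : (d : ℝ) ≤ y := by linarith
    exact_mod_cast this
  have hsn : s ≤ n := by
    have : (s : ℝ) ≤ n := by linarith
    exact_mod_cast this
  have hyn : y - d ≤ n - s := by
    have : (y : ℝ) + s ≤ n := by linarith
    have : y + s ≤ n := by exact_mod_cast this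
    omega
  refine ⟨hdy, ?_⟩
  have hβ : (0 : ℝ) ≤ 6 / L ^ 3 := by positivity
  have hcn : ((n - s : ℕ) : ℝ) = n - s := Nat.cast_sub hsn
  have hcy : ((y - d : ℕ) : ℝ) = y - d := Nat.cast_sub hdy
  have hcs : ((s - 1 : ℕ) : ℝ) = s - 1 := by rw [Nat.cast_sub hs1, Nat.cast_one]
  have hkey := abs_binHalf_sub_le_pow hβ (s - 1) d (by omega) (n - s) (y - d) (by
    rw [hcn, hcy, hcs]
    have : 3 * B ≤ 6 / L ^ 3 * (n - s) := by
      have : 6 / L ^ 3 * (n - s) = 6 * B - 6 * s / L ^ 3 := by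
        rw [hBdef]
        ring
      rw [this]
      have : 6 * (s : ℝ) / L ^ 3 ≤ 6 * s := div_le_self (by positivity) (by linarith)
      linarith
    rw [← le_sub_iff_add_le, abs_le]
    constructor <;> linarith) hyn
  have e1 : n - s + (s - 1) = n - 1 := by omega
  have e2 : y - d + d = y := by omega
  rw [e1, e2] at hkey
  refine hkey.trans (mul_le_mul_of_nonneg_right ?_ (binHalf_nonneg _ _))
  have hsβ : ((s - 1 : ℕ) : ℝ) * (6 / L ^ 3) ≤ 36 / L ^ 2 := by
    rw [hcs, ← mul_div_assoc, div_le_div_iff₀ (by positivity) (by positivity)]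
    have : (s - 1) * 6 * L ^ 2 ≤ (6 * L) * 6 * L ^ 2 := by gcongr; linarith
    linarith
  have h36 : 36 / L ^ 2 ≤ 1 := by
    rw [div_le_one (by positivity)]
    nlinarith
  refine (one_add_pow_sub_one_le hβ (hsβ.trans h36)).trans ?_
  calc 2 * (((s - 1 : ℕ) : ℝ) * (6 / L ^ 3)) ≤ 2 * (36 / L ^ 2) := by gcongr
    _ = 72 / L ^ 2 := by ring
    _ ≤ 1 / (96 * l) := by
      rw [div_le_div_iff₀ (by positivity) (by positivity)]
      nlinarith

theorem eventually_abs_binHalf_succ_sub_le : ∀ᶠ n : ℕ in atTop, ∀ y : ℕ,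
    |2 * (y : ℝ) - n| ≤ degreeWidth n + 4 → y + 1 ≤ n ∧
      |binHalf (n - 1) (y + 1) - binHalf (n - 1) y| ≤
        1 / (8 * Real.log (Real.log n)) * binHalf (n - 1) y := by
  filter_upwards [eventually_log_bounds] with n hn y hy
  obtain ⟨h1, h2, h3⟩ := hn
  obtain ⟨hl1, hlL, -, -, hR⟩ := degreeWidth_bounds h1 h2 h3
  set R := degreeWidth n
  set L := Real.log n with hL
  set l := Real.log L with hl
  have hL0 : 0 < L := by linarith
  have hL3 : 10 ^ 6 * L ≤ L ^ 3 := by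
    have : 10 ^ 6 ≤ L ^ 2 := h1.trans (le_self_pow₀ (by linarith) (by norm_num))
    calc 10 ^ 6 * L ≤ L ^ 2 * L := by gcongr
      _ = L ^ 3 := by ring
  have hB : 10 ^ 6 ≤ n / L ^ 3 := by
    rw [le_div_iff₀ (by positivity)]
    calc 10 ^ 6 * L ^ 3 ≤ L * L ^ 3 := by gcongr
      _ = L ^ 4 := by ring
      _ ≤ L ^ 8 := pow_le_pow_right₀ (by linarith) (by norm_num)
      _ ≤ n := h3
  have hBn : 10 ^ 6 * (n / L ^ 3 * L) ≤ n := by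
    have : 10 ^ 6 * (n / L ^ 3 * L) = (10 ^ 6 * L) * n / L ^ 3 := by ring
    rw [this, div_le_iff₀ (by positivity), mul_comm]
    gcongr
  set B := (n : ℝ) / L ^ 3 with hBdef
  have hBL : B ≤ B * l := by nlinarith
  have hBl : B * l ≤ B * L := by gcongr
  obtain ⟨hy1, hy2⟩ := abs_le.1 hy
  have hyn : y + 1 ≤ n := by
    have : (y : ℝ) + 1 ≤ n := by linarith
    exact_mod_cast this
  refine ⟨hyn, ?_⟩
  rw [abs_binHalf_succ_sub_le (by omega)]
  refine mul_le_mul_of_nonneg_right ?_ (binHalf_nonneg _ _)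
  have hcn : ((n - 1 : ℕ) : ℝ) = n - 1 := by exact_mod_cast Nat.cast_sub (by omega : 1 ≤ n)
  rw [hcn, div_le_div_iff₀ (by positivity) (by positivity)]
  have : |(n : ℝ) - 1 - 1 - 2 * y| ≤ 2 * B := by
    rw [abs_le]
    constructor <;> linarith
  calc |(n : ℝ) - 1 - 1 - 2 * y| * (8 * l) ≤ 2 * B * (8 * l) := by gcongr
    _ = 16 * (B * l) := by ring
    _ ≤ 1 * (y + 1) := by linarith

theorem eventually_gprob_abs_Ncount_sub_ge_le : ∀ᶠ n : ℕ in atTop, ∀ y : ℕ,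
    |2 * (y : ℝ) - n| ≤ degreeWidth n + 4 →
      gprob {G : SimpleGraph (Fin n) | n * binHalf (n - 1) y / (8 * Real.log (Real.log n)) ≤
        |(Ncount G y : ℝ) - n * binHalf (n - 1) y|} ≤ ((n : ℝ) ^ 2)⁻¹ := by
  filter_upwards [eventually_log_bounds, eventually_le_mul_binHalf,
    eventually_abs_binHalf_sub_le] with n hn hμ hq y hy
  obtain ⟨h1, h2, h3⟩ := hn
  obtain ⟨hl1, hlL, -, -, -⟩ := degreeWidth_bounds h1 h2 h3
  replace hμ := hμ y hy
  replace hq := hq y hy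
  set L := Real.log n with hL
  set l := Real.log L with hl
  set r := ⌈2 * L⌉₊ with hr
  set p := binHalf (n - 1) y with hp
  have hL0 : 0 < L := by linarith
  have hn0 : (0 : ℝ) < n := lt_of_lt_of_le (by positivity) h3
  have hr1 : 2 * L ≤ r := Nat.le_ceil _
  have hr2 : (r : ℝ) ≤ 3 * L := by
    have := Nat.ceil_lt_add_one (show 0 ≤ 2 * L by positivity)
    linarith
  have hr0 : (0 : ℝ) < r := by linarith
  have hμ' : 10 ^ 6 * (L * l ^ 2) ≤ n * p := by
    have : L ^ ((5 : ℝ) / 4) = L * L ^ ((1 : ℝ) / 4) := by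
      rw [← Real.rpow_one_add' hL0.le (by norm_num)]
      norm_num
    rw [this] at hμ
    have : L * (10 ^ 6 * l ^ 2) ≤ L * L ^ ((1 : ℝ) / 4) := by gcongr
    nlinarith [mul_pos hL0 (pow_pos (by linarith : 0 < l) 2)]
  have hμ0 : 0 < n * p := lt_of_lt_of_le (by positivity) hμ'
  have hp0 : 0 ≤ p := binHalf_nonneg _ _
  set t := n * p / (8 * l) with ht
  have ht0 : 0 < t := by positivity
  have hl1' : 6 * r / t ≤ 1 := by
    rw [div_le_one ht0, ht, le_div_iff₀ (by positivity)]
    have : 6 * r * (8 * l) ≤ 144 * (L * l) := by nlinarith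
    have : L * l ≤ L * l ^ 2 := by
      gcongr
      nlinarith
    nlinarith [mul_pos hL0 (by linarith : 0 < l)]
  have hη1 : 1 / (96 * l) ≤ 1 := by
    rw [div_le_one (by positivity)]
    linarith
  refine (gprob_abs_Ncount_sub_ge_le y r (η := 1 / (96 * l)) (l := 6 * r / t) hp0
    (binHalf_le_one _ _) (by positivity) hη1 (by positivity) hl1' ht0 hq).trans ?_
  have e1 : 6 * r / t * t = 6 * r := by field_simp
  have hfac : ((2 * r).factorial : ℝ) / (6 * r) ^ (2 * r) ≤ Real.exp (-2 * r) := by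
    have hf : ((2 * r).factorial : ℝ) ≤ (2 * r) ^ (2 * r) := by
      exact_mod_cast Nat.factorial_le_pow (2 * r)
    have he : Real.exp (-2 * r) = (Real.exp 1)⁻¹ ^ (2 * r) := by
      rw [← Real.exp_neg, ← Real.exp_nat_mul]
      congr 1
      push_cast
      ring
    calc ((2 * r).factorial : ℝ) / (6 * r) ^ (2 * r) ≤ (2 * r) ^ (2 * r) / (6 * r) ^ (2 * r) := by
          gcongr
      _ = (3 : ℝ)⁻¹ ^ (2 * r) := by
          rw [← div_pow]
          congr 1
          field_simp
          norm_num
      _ ≤ (Real.exp 1)⁻¹ ^ (2 * r) := by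
          gcongr
          linarith [Real.exp_one_lt_d9]
      _ = _ := he.symm
  have hexp : n * (6 * r / t * p * (1 / (96 * l)) + 3 * p * (6 * r / t) ^ 2) ≤ r := by
    have : n * (6 * r / t * p * (1 / (96 * l)) + 3 * p * (6 * r / t) ^ 2) =
        r / 2 + r * (6912 * (r * l ^ 2)) / (n * p) := by
      have hp' : p ≠ 0 := by
        rintro h
        simp [h] at hμ0
      rw [ht]
      field_simp
      ring
    rw [this]
    have : r * (6912 * (r * l ^ 2)) / (n * p) ≤ r * (1 / 2) := by
      have h3L : r * l ^ 2 ≤ 3 * L * l ^ 2 := by gcongr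
      have hLl : 0 ≤ L * l ^ 2 := by positivity
      have : 6912 * (r * l ^ 2) ≤ 1 / 2 * (n * p) := by linarith
      rw [div_le_iff₀ hμ0, mul_assoc]
      exact mul_le_mul_of_nonneg_left this hr0.le
    linarith
  rw [e1]
  calc ((2 * r).factorial : ℝ) / (6 * r) ^ (2 * r) *
        Real.exp (n * (6 * r / t * p * (1 / (96 * l)) + 3 * p * (6 * r / t) ^ 2))
      ≤ Real.exp (-2 * r) * Real.exp r := by gcongr
    _ = Real.exp (-r) := by
        rw [← Real.exp_add]
        congr 1
        ring
    _ ≤ Real.exp (-(2 * L)) := by gcongr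
    _ = ((n : ℝ) ^ 2)⁻¹ := by
        rw [Real.exp_neg, two_mul, Real.exp_add, hL, Real.exp_log hn0, sq]

theorem frequent_degree_of_abs_sub_lt {a b μ ν l x : ℝ} (hl : 1 ≤ l) (hμ : 3 / 2 * x ≤ μ)
    (hx : 0 ≤ x) (ha : |a - μ| < μ / (8 * l)) (hb : |b - ν| < ν / (8 * l))
    (hμν : |ν - μ| ≤ 1 / (8 * l) * μ) : x ≤ a ∧ |a - b| ≤ a / l := by
  have hl0 : 0 < l := by linarith
  set ε := 1 / (8 * l) with hε
  have hε0 : 0 < ε := by positivity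
  have hε1 : ε ≤ 1 / 8 := by
    rw [hε, div_le_div_iff₀ (by positivity) (by norm_num)]
    linarith
  have e1 : μ / (8 * l) = ε * μ := by rw [hε]; ring
  have e2 : ν / (8 * l) = ε * ν := by rw [hε]; ring
  have e3 : a / l = 8 * ε * a := by rw [hε]; field_simp
  rw [e1] at ha
  rw [e2] at hb
  rw [e3]
  have hμ0 : 0 ≤ μ := by linarith
  obtain ⟨ha1, ha2⟩ := abs_lt.1 ha
  obtain ⟨hb1, hb2⟩ := abs_lt.1 hb
  obtain ⟨hc1, hc2⟩ := abs_le.1 hμν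
  have hεμ : ε * μ ≤ 1 / 8 * μ := by gcongr
  have hν : ν ≤ 9 / 8 * μ := by linarith
  have hεν : ε * ν ≤ ε * (9 / 8 * μ) := by gcongr
  have hεa : ε * (7 / 8 * μ) ≤ ε * a := by
    gcongr
    linarith
  have hεμ0 : 0 ≤ ε * μ := by positivity
  refine ⟨by linarith, ?_⟩
  rw [abs_le]
  constructor <;> linarith

/-- Whp, for every integer `y` with `|y − n/2| < (1/2)·√(n·ln n·(1−ζ₂)) + 1`, one has
`N_y ≥ (ln n)^{5/4}` and `|N_y − N_{y+1}| ≤ N_y / ln ln n`. -/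
theorem frequent_degrees_whp :
    Tendsto (fun n : ℕ => gprob {G : SimpleGraph (Fin n) |
      ∀ y : ℤ, |(y : ℝ) - (n : ℝ) / 2| <
          (1 / 2) * Real.sqrt ((n : ℝ) * Real.log n * (1 - zeta2 n)) + 1 →
        Real.log n ^ ((5 : ℝ) / 4) ≤ (Ncount G y : ℝ) ∧
        |(Ncount G y : ℝ) - (Ncount G (y + 1) : ℝ)| ≤
          (Ncount G y : ℝ) / Real.log (Real.log n)}) atTop (nhds 1) := by
  have hlim : Tendsto (fun n : ℕ => 1 - ((n : ℝ) + 1) * ((n : ℝ) ^ 2)⁻¹) atTop (nhds 1) := by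
    have h1 : Tendsto (fun n : ℕ => ((n : ℝ))⁻¹) atTop (nhds 0) :=
      tendsto_inv_atTop_nhds_zero_nat
    have h2 : Tendsto (fun n : ℕ => 1 - ((n : ℝ)⁻¹ + (n : ℝ)⁻¹ * (n : ℝ)⁻¹)) atTop
        (nhds (1 - (0 + 0 * 0))) := tendsto_const_nhds.sub (h1.add (h1.mul h1))
    norm_num at h2
    refine h2.congr' ?_
    filter_upwards [eventually_ge_atTop 1] with n hn
    have : (n : ℝ) ≠ 0 := by positivity
    field_simp
  have hmain : ∀ᶠ n : ℕ in atTop, 1 - ((n : ℝ) + 1) * ((n : ℝ) ^ 2)⁻¹ ≤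
      gprob {G : SimpleGraph (Fin n) |
        ∀ y : ℤ, |(y : ℝ) - (n : ℝ) / 2| <
            (1 / 2) * Real.sqrt ((n : ℝ) * Real.log n * (1 - zeta2 n)) + 1 →
          Real.log n ^ ((5 : ℝ) / 4) ≤ (Ncount G y : ℝ) ∧
          |(Ncount G y : ℝ) - (Ncount G (y + 1) : ℝ)| ≤
            (Ncount G y : ℝ) / Real.log (Real.log n)} ∧
      gprob {G : SimpleGraph (Fin n) |
        ∀ y : ℤ, |(y : ℝ) - (n : ℝ) / 2| <
            (1 / 2) * Real.sqrt ((n : ℝ) * Real.log n * (1 - zeta2 n)) + 1 →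
          Real.log n ^ ((5 : ℝ) / 4) ≤ (Ncount G y : ℝ) ∧
          |(Ncount G y : ℝ) - (Ncount G (y + 1) : ℝ)| ≤
            (Ncount G y : ℝ) / Real.log (Real.log n)} ≤ 1 := by
    filter_upwards [eventually_log_bounds, eventually_le_mul_binHalf,
      eventually_abs_binHalf_succ_sub_le, eventually_gprob_abs_Ncount_sub_ge_le]
      with n hn hμ hsucc hconc
    obtain ⟨h1, h2, h3⟩ := hn
    obtain ⟨hl1, -, -, -, hR⟩ := degreeWidth_bounds h1 h2 h3
    set R := degreeWidth n with hRdef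
    have hRn : R + 4 ≤ n := by
      have hL1 : 1 ≤ Real.log n := by linarith
      have e1 : (n : ℝ) / Real.log n ^ 3 ≤ n / 2 := by
        gcongr
        have : Real.log n ≤ Real.log n ^ 3 := le_self_pow₀ hL1 (by norm_num)
        linarith
      have e2 : Real.log n ≤ Real.log n ^ 8 := le_self_pow₀ hL1 (by norm_num)
      linarith
    have hmem : ∀ y : ℕ, |2 * (y : ℝ) - n| ≤ R + 4 → y ∈ Finset.range (n + 1) := fun y hy => by
      have := (hsucc y hy).1
      rw [Finset.mem_range]
      omega
    classical
    have hF : (((Finset.range (n + 1)).filter fun y : ℕ => |2 * (y : ℝ) - n| ≤ R + 4).card : ℝ) ≤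
        n + 1 := by
      have := Finset.card_filter_le (Finset.range (n + 1)) fun y : ℕ => |2 * (y : ℝ) - n| ≤ R + 4
      rw [Finset.card_range] at this
      exact_mod_cast this
    refine (gprob_le_of_subset_biUnion _
      ((Finset.range (n + 1)).filter fun y : ℕ => |2 * (y : ℝ) - n| ≤ R + 4)
      (fun y => {G : SimpleGraph (Fin n) | n * binHalf (n - 1) y / (8 * Real.log (Real.log n)) ≤
        |(Ncount G y : ℝ) - n * binHalf (n - 1) y|}) ((n : ℝ) ^ 2)⁻¹ ?_
      (fun y hy => hconc y (Finset.mem_filter.1 hy).2)).imp_left fun h => le_trans ?_ h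
    · rw [Set.compl_subset_comm]
      intro G hG y hy
      simp only [Set.mem_compl_iff, Set.mem_iUnion, Set.mem_ofPred_eq, not_exists, not_le] at hG
      have hG' : ∀ y : ℕ, |2 * (y : ℝ) - n| ≤ R + 4 → |(Ncount G y : ℝ) - n * binHalf (n - 1) y| <
          n * binHalf (n - 1) y / (8 * Real.log (Real.log n)) := fun y hy =>
        hG y (Finset.mem_filter.2 ⟨hmem y hy, hy⟩)
      change |(y : ℝ) - (n : ℝ) / 2| < 1 / 2 * R + 1 at hy
      obtain ⟨hy1, hy2⟩ := abs_lt.1 hy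
      have hy0 : 0 ≤ y := by
        have : (0 : ℝ) ≤ y := by linarith
        exact_mod_cast this
      lift y to ℕ using hy0
      rw [Int.cast_natCast] at hy1 hy2
      have hya : |2 * (y : ℝ) - n| ≤ R + 4 := by
        rw [abs_le]
        constructor <;> linarith
      have hyb : |2 * ((y + 1 : ℕ) : ℝ) - n| ≤ R + 4 := by
        push_cast
        rw [abs_le]
        constructor <;> linarith
      have hb := hG' (y + 1) hyb
      rw [Nat.cast_succ] at hb
      refine frequent_degree_of_abs_sub_lt hl1 (hμ y hya) (Real.rpow_nonneg (by linarith) _)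
        (hG' y hya) hb ?_
      rw [← mul_sub, abs_mul, abs_of_nonneg (Nat.cast_nonneg n), mul_left_comm]
      exact mul_le_mul_of_nonneg_left (hsucc y hya).2 (Nat.cast_nonneg n)
    · gcongr
  exact tendsto_of_tendsto_of_tendsto_of_le_of_le' hlim tendsto_const_nhds
    (hmain.mono fun _ h => h.1) (hmain.mono fun _ h => h.2)
end

section
/- With high probability, for all but at most √n vertices i of G_n the following implication holds: if the degree ξ_i of vertex i satisfies (1/2)·√(n·ln n·(1−ζ₂)) ≤ |ξ_i − n/2| ≤ (1/2)·√(n·ln n·(1−ζ₁)), then for each of the three values y ∈ {ξ_i − 1, ξ_i, ξ_i + 1} one has N_y ≥ (ln n)^{3/4}, |N_y − N_{y+1}| ≤ N_y / ln ln n, and |N_y − N_{y−1}| ≤ N_y / ln ln n. -/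
open Filter

open Finset in
/-- Independence of the traces of a random subset on two disjoint sets. -/
lemma sum_powerset_union_mul {α : Type*} [DecidableEq α] {A B : Finset α} (h : Disjoint A B)
    (f g : Finset α → ℝ) :
    ∑ T ∈ (A ∪ B).powerset, f (T ∩ A) * g (T ∩ B) =
      (∑ T ∈ A.powerset, f T) * ∑ T ∈ B.powerset, g T := by
  rw [sum_mul_sum, ← sum_product']
  refine sum_nbij' (fun T => (T ∩ A, T ∩ B)) (fun P => P.1 ∪ P.2) ?_ ?_ ?_ ?_ ?_
  · intro T _
    simp
  · intro P hP
    simp only [mem_product, mem_powerset] at hP ⊢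
    exact union_subset_union hP.1 hP.2
  · intro T hT
    simp only [mem_powerset] at hT
    rw [← inter_union_distrib_left, inter_eq_left.2 hT]
  · rintro ⟨P, Q⟩ hP
    simp only [mem_product, mem_powerset] at hP
    have h1 : Q ∩ A = ∅ := disjoint_iff_inter_eq_empty.1 (h.symm.mono_left hP.2)
    have h2 : P ∩ B = ∅ := disjoint_iff_inter_eq_empty.1 (h.mono_left hP.1)
    simp [union_inter_distrib_right, h1, h2, inter_eq_left.2 hP.1, inter_eq_left.2 hP.2]
  · intro T _
    rfl

open Finset in
lemma sum_powerset_card_eq {α : Type*} [DecidableEq α] (A : Finset α) (a : ℕ) :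
    ∑ T ∈ A.powerset, (if #T = a then (1 : ℝ) else 0) = (#A).choose a := by
  rw [sum_boole, ← powersetCard_eq_filter, card_powersetCard]

open Finset in
lemma sum_powerset_card_inter_eq {α : Type*} [DecidableEq α] {A U : Finset α} (h : A ⊆ U)
    (a : ℕ) :
    ∑ T ∈ U.powerset, (if #(T ∩ A) = a then (1 : ℝ) else 0) =
      (#A).choose a * 2 ^ (#U - #A) := by
  have := sum_powerset_union_mul (disjoint_sdiff (s := A) (t := U))
    (fun T => if #T = a then (1 : ℝ) else 0) (fun _ => 1)
  rw [union_sdiff_of_subset h, sum_powerset_card_eq] at this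
  simpa [card_powerset, card_sdiff_of_subset h] using this

open Finset in
lemma sum_powerset_card_inter_eq_and {α : Type*} [DecidableEq α] {A B U : Finset α}
    (hA : A ⊆ U) (hB : B ⊆ U) (hAB : Disjoint A B) (a b : ℕ) :
    ∑ T ∈ U.powerset, (if #(T ∩ A) = a ∧ #(T ∩ B) = b then (1 : ℝ) else 0) =
      (#A).choose a * (#B).choose b * 2 ^ (#U - #A - #B) := by
  have hB' : B ⊆ U \ A := subset_sdiff.2 ⟨hB, hAB.symm⟩
  have := sum_powerset_union_mul (disjoint_sdiff (s := A) (t := U))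
    (fun T => if #T = a then (1 : ℝ) else 0) (fun T => if #(T ∩ B) = b then (1 : ℝ) else 0)
  rw [union_sdiff_of_subset hA, sum_powerset_card_eq, sum_powerset_card_inter_eq hB',
    card_sdiff_of_subset hA] at this
  rw [mul_assoc, ← this]
  refine sum_congr rfl fun T _ => ?_
  rw [inter_assoc, inter_eq_right.2 hB', ite_and]
  split_ifs <;> simp

open Finset in
/-- Joint law of the traces on two sets that share exactly one point. -/
lemma sum_powerset_card_inter_insert {α : Type*} [DecidableEq α] {A B U : Finset α} {c : α}
    (hA : A ⊆ U) (hB : B ⊆ U) (hAB : Disjoint A B) (hc : c ∉ U) (k : ℕ) :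
    ∑ T ∈ (insert c U).powerset,
        (if #(T ∩ insert c A) = k + 1 ∧ #(T ∩ insert c B) = k + 1 then (1 : ℝ) else 0) =
      ((#A).choose (k + 1) * (#B).choose (k + 1) + (#A).choose k * (#B).choose k) *
        2 ^ (#U - #A - #B) := by
  rw [sum_powerset_insert hc, add_mul, ← sum_powerset_card_inter_eq_and hA hB hAB,
    ← sum_powerset_card_inter_eq_and hA hB hAB]
  congr 1
  · refine sum_congr rfl fun T hT => ?_
    have : c ∉ T := fun h => hc (mem_powerset.1 hT h)
    rw [inter_insert_of_notMem this, inter_insert_of_notMem this]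
  · refine sum_congr rfl fun T hT => ?_
    have hT' : c ∉ T := fun h => hc (mem_powerset.1 hT h)
    have h1 : insert c T ∩ insert c A = insert c (T ∩ A) := by
      rw [← insert_inter_distrib]
    have h2 : insert c T ∩ insert c B = insert c (T ∩ B) := by
      rw [← insert_inter_distrib]
    rw [h1, h2, card_insert_of_notMem (by simp [hT']), card_insert_of_notMem (by simp [hT'])]
    simp

open Finset in
lemma sum_simpleGraph_eq {V : Type*} [Fintype V] [DecidableEq V] (F : Finset (Sym2 V) → ℝ) :
    ∑ G : SimpleGraph V, F G.edgeSet.toFinite.toFinset =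
      ∑ T ∈ (⊤ : SimpleGraph V).edgeFinset.powerset, F T := by
  refine sum_nbij' (fun G => G.edgeSet.toFinite.toFinset)
    (fun T => SimpleGraph.fromEdgeSet (T : Set (Sym2 V))) ?_ ?_ ?_ ?_ ?_
  · intro G _
    simp only [mem_powerset]
    intro e he
    simp only [Set.Finite.mem_toFinset] at he
    rw [SimpleGraph.mem_edgeFinset]
    exact SimpleGraph.edgeSet_mono le_top he
  · intro T _
    simp
  · intro G _
    simp
  · intro T hT
    simp only [mem_powerset] at hT
    ext e
    simp only [SimpleGraph.edgeSet_fromEdgeSet, Set.Finite.mem_toFinset, Set.mem_sdiff, mem_coe]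
    refine ⟨fun h => h.1, fun h => ⟨h, ?_⟩⟩
    have := hT h
    rw [SimpleGraph.mem_edgeFinset] at this
    exact SimpleGraph.not_isDiag_of_mem_edgeSet _ this
  · intro G _
    rfl

open Finset in
lemma ndeg_eq_card_inter {V : Type*} [Fintype V] [DecidableEq V] (G : SimpleGraph V) (i : V) :
    ndeg G i = #(G.edgeSet.toFinite.toFinset ∩ (⊤ : SimpleGraph V).incidenceFinset i) := by
  classical
  have h1 : ndeg G i = G.degree i := by
    rw [ndeg, Nat.card_eq_fintype_card, SimpleGraph.card_neighborSet_eq_degree]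
  rw [h1, ← SimpleGraph.card_incidenceFinset_eq_degree]
  congr 1
  ext e
  simp only [SimpleGraph.mem_incidenceFinset, mem_inter, Set.Finite.mem_toFinset,
    SimpleGraph.incidenceSet, Set.mem_ofPred_eq]
  constructor
  · rintro ⟨h1, h2⟩
    exact ⟨h1, SimpleGraph.edgeSet_mono le_top h1, h2⟩
  · rintro ⟨h1, -, h2⟩
    exact ⟨h1, h2⟩

open Finset in
lemma card_incidenceFinset_top {n : ℕ} (i : Fin n) :
    #((⊤ : SimpleGraph (Fin n)).incidenceFinset i) = n - 1 := by
  rw [SimpleGraph.card_incidenceFinset_eq_degree, SimpleGraph.complete_graph_degree,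
    Fintype.card_fin]

lemma choose_two_eq_add {n : ℕ} (hn : 1 ≤ n) : n.choose 2 = (n - 1).choose 2 + (n - 1) := by
  obtain ⟨m, rfl⟩ := Nat.exists_eq_add_of_le' hn
  simp [Nat.choose_succ_succ, add_comm]

open Finset in
/-- The degree of a vertex of a uniformly random graph is binomial. -/
lemma sum_graph_ndeg_eq {n : ℕ} (i : Fin n) (z : ℕ) :
    ∑ G : SimpleGraph (Fin n), (if ndeg G i = z then (1 : ℝ) else 0) =
      2 ^ (n.choose 2) * ((n - 1).choose z / 2 ^ (n - 1)) := by
  have hn : 1 ≤ n := by have := i.2; omega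
  simp_rw [ndeg_eq_card_inter]
  rw [sum_simpleGraph_eq (fun T => if #(T ∩ (⊤ : SimpleGraph (Fin n)).incidenceFinset i) = z
    then (1 : ℝ) else 0), sum_powerset_card_inter_eq (SimpleGraph.incidenceFinset_subset _ _),
    card_incidenceFinset_top, SimpleGraph.card_edgeFinset_top_eq_card_choose_two,
    Fintype.card_fin, choose_two_eq_add hn, Nat.add_sub_cancel, pow_add]
  field_simp

open Finset in
/-- The joint law of the degrees of two vertices of a uniformly random graph. -/
lemma sum_graph_ndeg_eq_and {n : ℕ} {i j : Fin n} (hij : i ≠ j) (k : ℕ) :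
    ∑ G : SimpleGraph (Fin n), (if ndeg G i = k + 1 ∧ ndeg G j = k + 1 then (1 : ℝ) else 0) =
      2 ^ (n.choose 2) * ((((n - 2).choose (k + 1) : ℝ) ^ 2 + ((n - 2).choose k : ℝ) ^ 2) /
        2 ^ (2 * (n - 2) + 1)) := by
  have hn : 2 ≤ n := by
    by_contra h
    exact hij (Fin.ext (by have := i.2; have := j.2; omega))
  set K : SimpleGraph (Fin n) := ⊤ with hK
  set c : Sym2 (Fin n) := s(i, j) with hc
  set A := (K.incidenceFinset i).erase c with hA
  set B := (K.incidenceFinset j).erase c with hB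
  set U := K.edgeFinset.erase c with hU
  have hcE : c ∈ K.edgeFinset := by simp [hK, hc, hij]
  have hci : c ∈ K.incidenceFinset i := by simp [hK, hc, hij, SimpleGraph.incidenceSet]
  have hcj : c ∈ K.incidenceFinset j := by simp [hK, hc, hij, SimpleGraph.incidenceSet]
  have hAB : Disjoint A B := by
    rw [Finset.disjoint_left]
    intro e he1 he2
    simp only [hA, hB, mem_erase, SimpleGraph.mem_incidenceFinset,
      SimpleGraph.incidenceSet, Set.mem_ofPred_eq] at he1 he2
    exact he1.1 ((Sym2.mem_and_mem_iff hij).1 ⟨he1.2.2, he2.2.2⟩)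
  have key := sum_powerset_card_inter_insert (A := A) (B := B) (U := U) (c := c)
    (erase_subset_erase _ (SimpleGraph.incidenceFinset_subset _ _))
    (erase_subset_erase _ (SimpleGraph.incidenceFinset_subset _ _)) hAB
    (by simp [hU]) k
  have cA : #A = n - 2 := by
    rw [hA, card_erase_of_mem hci, card_incidenceFinset_top]; omega
  have cB : #B = n - 2 := by
    rw [hB, card_erase_of_mem hcj, card_incidenceFinset_top]; omega
  have cU : #U - #A - #B = (n - 2).choose 2 := by
    rw [hU, card_erase_of_mem hcE, SimpleGraph.card_edgeFinset_top_eq_card_choose_two,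
      Fintype.card_fin, cA, cB, choose_two_eq_add (n := n) (by omega),
      choose_two_eq_add (n := n - 1) (by omega)]
    have : n - 1 - 1 = n - 2 := by omega
    rw [this]; omega
  have cn : n.choose 2 = (n - 2).choose 2 + (2 * (n - 2) + 1) := by
    rw [choose_two_eq_add (n := n) (by omega), choose_two_eq_add (n := n - 1) (by omega)]
    have : n - 1 - 1 = n - 2 := by omega
    rw [this]; omega
  rw [hU, hA, hB, insert_erase hcE, insert_erase hci, insert_erase hcj, ← hU, ← hA, ← hB,
    cU, cA, cB] at key
  simp_rw [ndeg_eq_card_inter]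
  rw [sum_simpleGraph_eq (fun T => if #(T ∩ K.incidenceFinset i) = k + 1 ∧
    #(T ∩ K.incidenceFinset j) = k + 1 then (1 : ℝ) else 0), key, cn, pow_add]
  field_simp

/-- The expected number of vertices of degree `y` in a uniformly random graph on `Fin n`. -/
noncomputable def meanCount (n : ℕ) (y : ℤ) : ℝ :=
  n * ((n - 1).choose y.toNat / 2 ^ (n - 1))

lemma meanCount_nonneg (n : ℕ) (y : ℤ) : 0 ≤ meanCount n y := by
  unfold meanCount
  positivity

/-- Chebyshev's inequality for one atom of the binomial distribution. -/
lemma choose_mul_sq_le (m z : ℕ) :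
    ((m.choose z : ℝ) / 2 ^ m) * ((m : ℝ) - 2 * z) ^ 2 ≤ m := by
  by_cases hz : z ≤ m
  · have h := congrArg (Polynomial.eval (1 / 2 : ℝ)) (bernsteinPolynomial.variance ℝ m)
    rw [Polynomial.eval_finsetSum] at h
    simp only [bernsteinPolynomial, nsmul_eq_mul, Polynomial.eval_mul, Polynomial.eval_pow,
      Polynomial.eval_sub, Polynomial.eval_natCast, Polynomial.eval_X, Polynomial.eval_one] at h
    have h1 := Finset.single_le_sum (f := fun x : ℕ => ((m : ℝ) * (1 / 2) - x) ^ 2 *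
      (m.choose x * (1 / 2) ^ x * (1 - 1 / 2) ^ (m - x))) (fun x _ => by
        have : (0 : ℝ) ≤ 1 - 1 / 2 := by norm_num
        positivity) (Finset.mem_range.2 (Nat.lt_succ_of_le hz))
    rw [h] at h1
    have h2 : ((1 : ℝ) / 2) ^ z * (1 - 1 / 2) ^ (m - z) = 1 / 2 ^ m := by
      rw [show (1 : ℝ) - 1 / 2 = 1 / 2 by norm_num, ← pow_add, Nat.add_sub_cancel' hz,
        one_div_pow]
    simp only [mul_assoc, h2] at h1
    have h3 : ((m.choose z : ℝ) / 2 ^ m) * ((m : ℝ) - 2 * z) ^ 2 =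
      4 * (((m : ℝ) * (1 / 2) - z) ^ 2 * (m.choose z * (1 / 2 ^ m))) := by ring
    rw [h3]
    linarith
  · rw [Nat.choose_eq_zero_of_lt (not_le.1 hz)]
    simp

lemma Ncount_eq_sum {n : ℕ} (G : SimpleGraph (Fin n)) (z : ℕ) :
    (Ncount G (z : ℤ) : ℝ) = ∑ i : Fin n, if ndeg G i = z then (1 : ℝ) else 0 := by
  classical
  rw [Finset.sum_boole, Ncount, ← Set.ncard_coe_finset]
  simp

lemma joint_prob_le {n : ℕ} (hn : 2 ≤ n) (k : ℕ) :
    (((n - 2).choose (k + 1) : ℝ) ^ 2 + ((n - 2).choose k : ℝ) ^ 2) / 2 ^ (2 * (n - 2) + 1) ≤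
      ((n - 1).choose (k + 1) / 2 ^ (n - 1) : ℝ) ^ 2 +
        ((n - 1).choose (k + 1) / 2 ^ (n - 1)) / (n - 1) := by
  obtain ⟨m, rfl⟩ := Nat.exists_eq_add_of_le' hn
  have hcheb := choose_mul_sq_le (m + 1) (k + 1)
  have e1 : m + 2 - 1 = m + 1 := rfl
  simp only [Nat.add_sub_cancel, e1]
  have hpas : ((m + 1).choose (k + 1) : ℝ) = m.choose k + m.choose (k + 1) := by
    rw [Nat.choose_succ_succ]; push_cast; rfl
  have hrat : (m.choose (k + 1) : ℝ) * (k + 1) = m.choose k * (m - k) := by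
    rcases le_or_gt k m with h | h
    · have := Nat.choose_succ_right_eq m k
      rw [← Nat.cast_sub h]
      exact_mod_cast this
    · rw [Nat.choose_eq_zero_of_lt h, Nat.choose_eq_zero_of_lt (by omega)]
      simp
  set p : ℝ := (m + 1).choose (k + 1) / 2 ^ (m + 1) with hp
  set a : ℝ := ((m.choose k : ℕ) : ℝ) with ha
  set b : ℝ := ((m.choose (k + 1) : ℕ) : ℝ) with hb
  have hp0 : 0 ≤ p := by rw [hp]; positivity
  have hab : a + b = p * 2 ^ (m + 1) := by rw [hp, ← hpas]; field_simp
  have hdiff : (b - a) * (m + 1) = (a + b) * ((m + 1 : ℝ) - 2 * (k + 1)) := by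
    linear_combination 2 * hrat
  have h2 : (b ^ 2 + a ^ 2) / 2 ^ (2 * m + 1) = p ^ 2 + ((b - a) / 2 ^ (m + 1)) ^ 2 := by
    have : p = (a + b) / 2 ^ (m + 1) := by rw [hab]; field_simp
    rw [this]
    field_simp
    ring
  have h3 : (b - a) / 2 ^ (m + 1) = p * ((m + 1 : ℝ) - 2 * (k + 1)) / (m + 1) := by
    rw [hab] at hdiff
    field_simp
    linear_combination hdiff
  rw [h2, h3]
  push_cast at hcheb ⊢
  have hm : (0 : ℝ) < m + 1 := by positivity
  have h4 : (p * ((m + 1 : ℝ) - 2 * (k + 1)) / (m + 1)) ^ 2 ≤ p / (m + 1) := by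
    rw [div_pow, div_le_div_iff₀ (by positivity) hm]
    nlinarith [mul_le_mul_of_nonneg_left hcheb (mul_nonneg hp0 hm.le)]
  have e2 : (m : ℝ) + 2 - 1 = m + 1 := by ring
  rw [e2]
  linarith

lemma sum_graph_one (n : ℕ) : ∑ _G : SimpleGraph (Fin n), (1 : ℝ) = 2 ^ (n.choose 2) := by
  have := sum_simpleGraph_eq (V := Fin n) (fun _ => 1)
  rw [this, Finset.sum_const, Finset.card_powerset,
    SimpleGraph.card_edgeFinset_top_eq_card_choose_two]
  simp

open Finset in
lemma sum_Ncount_sub_sq_le {n : ℕ} (hn : 2 ≤ n) {y : ℤ} (hy : 1 ≤ y) :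
    ∑ G : SimpleGraph (Fin n), ((Ncount G y : ℝ) - meanCount n y) ^ 2 ≤
      2 ^ (n.choose 2) * (2 * meanCount n y) := by
  obtain ⟨k, rfl⟩ : ∃ k : ℕ, y = ((k + 1 : ℕ) : ℤ) := ⟨(y - 1).toNat, by omega⟩
  set P : ℝ := 2 ^ (n.choose 2) with hP
  set p : ℝ := (n - 1).choose (k + 1) / 2 ^ (n - 1) with hp
  have hp0 : 0 ≤ p := by rw [hp]; positivity
  have hμ : meanCount n ((k + 1 : ℕ) : ℤ) = n * p := by
    rw [meanCount, Int.toNat_natCast]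
  set q : ℝ := (((n - 2).choose (k + 1) : ℝ) ^ 2 + ((n - 2).choose k : ℝ) ^ 2) /
    2 ^ (2 * (n - 2) + 1) with hq
  have hqle : q ≤ p ^ 2 + p / (n - 1) := joint_prob_le hn k
  have h1 : ∑ G : SimpleGraph (Fin n), (Ncount G ((k + 1 : ℕ) : ℤ) : ℝ) = P * (n * p) := by
    simp_rw [Ncount_eq_sum]
    rw [sum_comm]
    simp_rw [sum_graph_ndeg_eq]
    simp [hP, hp]
    ring
  have h2 : ∑ G : SimpleGraph (Fin n), (Ncount G ((k + 1 : ℕ) : ℤ) : ℝ) ^ 2 =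
      P * (n * p + n * (n - 1) * q) := by
    have e : ∀ i j : Fin n, ∑ G : SimpleGraph (Fin n),
        ((if ndeg G i = k + 1 then (1 : ℝ) else 0) * (if ndeg G j = k + 1 then (1 : ℝ) else 0)) =
        P * q + if i = j then P * p - P * q else 0 := by
      intro i j
      by_cases hij : i = j
      · subst hij
        rw [if_pos rfl, add_sub_cancel, hP, hp, ← sum_graph_ndeg_eq i (k + 1)]
        refine sum_congr rfl fun G _ => ?_
        split_ifs <;> simp
      · rw [if_neg hij, add_zero, hP, hq, ← sum_graph_ndeg_eq_and hij]
        refine sum_congr rfl fun G _ => ?_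
        rw [ite_and]
        split_ifs <;> simp
    simp_rw [Ncount_eq_sum, sq, sum_mul_sum]
    rw [sum_comm]
    simp_rw [sum_comm (s := (univ : Finset (SimpleGraph (Fin n))))]
    simp_rw [e, sum_add_distrib]
    simp
    ring
  have h3 : ∑ G : SimpleGraph (Fin n), ((Ncount G ((k + 1 : ℕ) : ℤ) : ℝ) - n * p) ^ 2 =
      P * (n * p + n * (n - 1) * q) - P * (n * p) ^ 2 := by
    calc _ = ∑ G : SimpleGraph (Fin n), ((Ncount G ((k + 1 : ℕ) : ℤ) : ℝ) ^ 2 -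
          (2 * (n * p)) * (Ncount G ((k + 1 : ℕ) : ℤ) : ℝ) + (n * p) ^ 2 * 1) :=
          sum_congr rfl fun G _ => by ring
      _ = _ := by
        rw [sum_add_distrib, sum_sub_distrib, ← mul_sum, ← mul_sum, h1, h2, sum_graph_one]
        ring
  rw [hμ, h3, ← mul_sub]
  refine mul_le_mul_of_nonneg_left ?_ (by positivity)
  have hn' : (2 : ℝ) ≤ n := by exact_mod_cast hn
  have h4 : (n : ℝ) * (n - 1) * q ≤ n * (n - 1) * p ^ 2 + n * p := by
    have h5 := mul_le_mul_of_nonneg_left hqle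
      (mul_nonneg (by linarith : (0 : ℝ) ≤ n) (by linarith : (0 : ℝ) ≤ n - 1))
    have h6 : (n : ℝ) * (n - 1) * (p / (n - 1)) = n * p := by
      have : (n : ℝ) - 1 ≠ 0 := by linarith
      field_simp
    rw [mul_add, h6] at h5
    exact h5
  nlinarith [mul_nonneg (by linarith : (0 : ℝ) ≤ n) (sq_nonneg p)]

lemma log_one_add_le {x : ℝ} (hx : |x| ≤ 1 / 2) :
    Real.log (1 + x) ≤ x - x ^ 2 / 2 + x ^ 3 / 3 + 2 * x ^ 4 := by
  have h := Real.abs_log_sub_add_sum_range_le (x := -x) (by rw [abs_neg]; linarith) 3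
  have h2 : |(-x)| ^ (3 + 1) / (1 - |(-x)|) ≤ 2 * x ^ 4 := by
    rw [abs_neg, div_le_iff₀ (by linarith)]
    have : |x| ^ (3 + 1) = x ^ 4 := (even_two_mul 2).pow_abs x
    rw [this]
    nlinarith [mul_nonneg ((even_two_mul 2).pow_nonneg x) (by linarith : 0 ≤ 1 / 2 - |x|)]
  have h3 := (abs_le.1 (h.trans h2)).2
  simp only [Finset.sum_range_succ, Finset.sum_range_zero, sub_neg_eq_add] at h3
  norm_num at h3
  linarith

/-- A quantitative upper bound for the binary relative entropy with respect to `1 / 2`. -/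
lemma mul_log_add_mul_log_le {k l : ℝ} (hk : 0 < k) (hl : 0 < l) (h : |k - l| ≤ (k + l) / 2) :
    k * Real.log k + l * Real.log l ≤ (k + l) * Real.log (k + l) - (k + l) * Real.log 2 +
      (k - l) ^ 2 / (2 * (k + l)) + 5 * (k - l) ^ 4 / (2 * (k + l) ^ 3) := by
  set m := k + l with hm
  have hm0 : 0 < m := by positivity
  set x := (k - l) / m with hx
  have hxm : x * m = k - l := by rw [hx]; field_simp
  have hxa : |x| ≤ 1 / 2 := by
    rw [hx, abs_div, abs_of_pos hm0, div_le_iff₀ hm0]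
    linarith
  have hk' : k = m / 2 * (1 + x) := by linarith
  have hl' : l = m / 2 * (1 + -x) := by linarith
  have hb := abs_le.1 hxa
  have lk : Real.log k = Real.log m - Real.log 2 + Real.log (1 + x) := by
    rw [hk', Real.log_mul (by positivity) (by linarith), Real.log_div hm0.ne' two_ne_zero]
  have ll : Real.log l = Real.log m - Real.log 2 + Real.log (1 + -x) := by
    rw [hl', Real.log_mul (by positivity) (by linarith), Real.log_div hm0.ne' two_ne_zero]
  have b1 := mul_le_mul_of_nonneg_left (log_one_add_le hxa) hk.le
  have b2 := mul_le_mul_of_nonneg_left (log_one_add_le (x := -x) (by rwa [abs_neg])) hl.le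
  have e : (k - l) ^ 2 / (2 * m) + 5 * (k - l) ^ 4 / (2 * m ^ 3) =
      m / 2 * (x ^ 2 + 5 * x ^ 4) := by
    rw [← hxm]; field_simp
  rw [lk, ll, add_assoc, e]
  have e2 : k * (x - x ^ 2 / 2 + x ^ 3 / 3 + 2 * x ^ 4) +
      l * (-x - (-x) ^ 2 / 2 + (-x) ^ 3 / 3 + 2 * (-x) ^ 4) =
      m / 2 * (x ^ 2 + 2 / 3 * x ^ 4 + 4 * x ^ 4) := by
    rw [hk', hl']; ring
  have e3 : m / 2 * (x ^ 2 + 2 / 3 * x ^ 4 + 4 * x ^ 4) ≤ m / 2 * (x ^ 2 + 5 * x ^ 4) := by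
    refine mul_le_mul_of_nonneg_left ?_ (by positivity)
    nlinarith [(even_two_mul 2).pow_nonneg x]
  have e4 : k * (Real.log m - Real.log 2 + Real.log (1 + x)) +
      l * (Real.log m - Real.log 2 + Real.log (1 + -x)) =
      m * Real.log m - m * Real.log 2 + (k * Real.log (1 + x) + l * Real.log (1 + -x)) := by
    rw [hm]; ring
  rw [e4]
  linarith

lemma eventually_log_factorial_le :
    ∀ᶠ k : ℕ in atTop, Real.log (k.factorial : ℝ) ≤ Real.log (11 / 10) +
      (k * Real.log k - k + Real.log k / 2 + Real.log (2 * Real.pi) / 2) := by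
  have hpi := Real.pi_pos
  have h1 : ∀ᶠ k : ℕ in atTop, Stirling.stirlingSeq k < 11 / 10 * √Real.pi :=
    Stirling.tendsto_stirlingSeq_sqrt_pi.eventually_lt_const (by
      have : 0 < √Real.pi := Real.sqrt_pos.2 hpi
      linarith)
  filter_upwards [h1, eventually_gt_atTop 0] with k hk hk0
  have hk0' : (0 : ℝ) < k := by exact_mod_cast hk0
  have hs : 0 < Stirling.stirlingSeq k :=
    (Real.sqrt_pos.2 hpi).trans_le (Stirling.sqrt_pi_le_stirlingSeq hk0.ne')
  have h2 := Real.log_le_log hs hk.le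
  rw [Stirling.log_stirlingSeq_formula, Real.log_mul (x := 11 / 10) (by norm_num) (by positivity),
    Real.log_sqrt hpi.le, Real.log_div hk0'.ne' (Real.exp_ne_zero _), Real.log_exp,
    Real.log_mul two_ne_zero hk0'.ne'] at h2
  rw [Real.log_mul two_ne_zero hpi.ne']
  linarith

/-- The local limit theorem (lower bound, moderate deviations) for the symmetric binomial
distribution. -/
lemma exists_forall_log_choose_ge :
    ∃ K : ℕ, ∀ k l : ℕ, K ≤ k → K ≤ l → |(k : ℝ) - l| ≤ (k + l) / 2 →
      Real.log 2 / 2 - Real.log Real.pi / 2 - Real.log (k + l) / 2 - 2 * Real.log (11 / 10) -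
          ((k : ℝ) - l) ^ 2 / (2 * (k + l)) - 5 * ((k : ℝ) - l) ^ 4 / (2 * (k + l) ^ 3) ≤
        Real.log ((k + l).choose k : ℝ) - (k + l) * Real.log 2 := by
  obtain ⟨K, hK⟩ := eventually_atTop.1 eventually_log_factorial_le
  refine ⟨K + 1, fun k l hk hl h => ?_⟩
  have hk0 : (0 : ℝ) < k := by exact_mod_cast (by omega : 0 < k)
  have hl0 : (0 : ℝ) < l := by exact_mod_cast (by omega : 0 < l)
  have hkf := hK k (by omega)
  have hlf := hK l (by omega)
  have hmf := Stirling.le_log_factorial_stirling (n := k + l) (by omega)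
  have hent := mul_log_add_mul_log_le hk0 hl0 h
  have hch : Real.log ((k + l).choose k : ℝ) = Real.log ((k + l).factorial : ℝ) -
      Real.log (k.factorial : ℝ) - Real.log (l.factorial : ℝ) := by
    have h1 := Nat.choose_mul_factorial_mul_factorial (Nat.le_add_right k l)
    rw [Nat.add_sub_cancel_left] at h1
    have h2 : ((k + l).choose k : ℝ) * k.factorial * l.factorial = (k + l).factorial := by
      exact_mod_cast h1
    have c0 : ((k + l).choose k : ℝ) ≠ 0 := by
      exact_mod_cast (Nat.choose_pos (Nat.le_add_right k l)).ne'
    rw [← h2, Real.log_mul (by positivity) (by positivity),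
      Real.log_mul c0 (by positivity)]
    ring
  have hkl : Real.log k + Real.log l ≤ 2 * Real.log (k + l) - 2 * Real.log 2 := by
    have h3 : (k : ℝ) * l ≤ ((k + l) / 2) ^ 2 := by nlinarith [sq_nonneg ((k : ℝ) - l)]
    have h4 := Real.log_le_log (by positivity) h3
    rw [Real.log_mul hk0.ne' hl0.ne', Real.log_pow, Real.log_div (by positivity) two_ne_zero]
      at h4
    push_cast at h4
    linarith
  push_cast at hmf
  rw [Real.log_mul two_ne_zero Real.pi_ne_zero] at hkf hlf hmf
  rw [hch]
  linarith

/-- The radius `√(n ln n (1 - ζ))` for `ζ = (ln (2π) + c ln ln n) / ln n`. -/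
noncomputable def windowRadius (n : ℕ) (c : ℝ) : ℝ :=
  √((n : ℝ) * (Real.log n - Real.log (2 * Real.pi) - c * Real.log (Real.log n)))

/-- The requirements on the size of `n` under which the estimates below hold. -/
structure IsLarge (n : ℕ) : Prop where
  one_le_log_log : 1 ≤ Real.log (Real.log n)
  log_sq_le : 10000 * Real.log n ^ 2 ≤ √n
  log_two_pi_le : Real.log (2 * Real.pi) + 5 / 2 * Real.log (Real.log n) ≤ Real.log n / 2

namespace IsLarge

variable {n : ℕ}

lemma one_le_log (h : IsLarge n) : 1 ≤ Real.log n := by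
  by_contra! hlt
  have h0 : 0 ≤ Real.log n := Real.log_natCast_nonneg n
  have := Real.log_nonpos h0 hlt.le
  linarith [h.one_le_log_log]

lemma log_log_le (h : IsLarge n) : Real.log (Real.log n) ≤ Real.log n :=
  Real.log_le_self (by linarith [h.one_le_log])

lemma large_sqrt (h : IsLarge n) : 10000 ≤ √(n : ℝ) := by
  nlinarith [h.one_le_log, h.log_sq_le]

lemma log_le_sqrt (h : IsLarge n) : 10000 * Real.log n ≤ √(n : ℝ) := by
  nlinarith [h.one_le_log, h.log_sq_le]

lemma windowRadius_sq (h : IsLarge n) {c : ℝ} (hc : c ≤ 5 / 2) :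
    windowRadius n c ^ 2 =
      n * (Real.log n - Real.log (2 * Real.pi) - c * Real.log (Real.log n)) := by
  refine Real.sq_sqrt (mul_nonneg n.cast_nonneg ?_)
  nlinarith [h.log_two_pi_le, h.one_le_log_log, h.one_le_log]

lemma windowRadius_le (h : IsLarge n) {c : ℝ} (hc : 0 ≤ c) :
    windowRadius n c ≤ √n * Real.log n := by
  have h1 := h.one_le_log
  have h2 : 0 ≤ Real.log (2 * Real.pi) := Real.log_nonneg (by linarith [Real.pi_gt_three])
  rw [windowRadius, Real.sqrt_le_left (by positivity), mul_pow, Real.sq_sqrt n.cast_nonneg]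
  refine mul_le_mul_of_nonneg_left ?_ n.cast_nonneg
  nlinarith [h.one_le_log_log, mul_nonneg hc (zero_le_one.trans h.one_le_log_log)]

/-- Integers in the (slightly enlarged) window are far from `0` and from `n`. -/
lemma window_bounds (h : IsLarge n) {z : ℤ}
    (hz : |(z : ℝ) - n / 2| ≤ windowRadius n (3 / 2) / 2 + 3) :
    ∃ k l : ℕ, z = k ∧ 1 ≤ k ∧ k + l = n - 1 ∧ (n : ℝ) / 4 ≤ k ∧ (n : ℝ) / 4 ≤ l ∧
      |(k : ℝ) - l| ≤ windowRadius n (3 / 2) + 7 := by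
  have hS := h.windowRadius_le (c := 3 / 2) (by norm_num)
  have hr := h.large_sqrt
  have hl := h.log_le_sqrt
  have hn : (n : ℝ) = √n ^ 2 := (Real.sq_sqrt n.cast_nonneg).symm
  have hS' : windowRadius n (3 / 2) ≤ n / 10000 := by
    rw [hn]; nlinarith
  have hn' : (10000 : ℝ) ≤ n := by rw [hn]; nlinarith
  obtain ⟨hz1, hz2⟩ := abs_le.1 hz
  have hzpos : (1 : ℝ) < z := by linarith
  have hzlt : (z : ℝ) < n - 1 := by linarith
  have e1 : 1 < z := by exact_mod_cast hzpos
  have e2 : z < n - 1 := by exact_mod_cast hzlt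
  obtain ⟨k, rfl⟩ : ∃ k : ℕ, z = k := ⟨z.toNat, by omega⟩
  obtain ⟨l, hl'⟩ : ∃ l : ℕ, k + l = n - 1 := ⟨n - 1 - k, by omega⟩
  have hsum : (k : ℝ) + l = n - 1 := by
    have : k + l + 1 = n := by omega
    rw [← this]; push_cast; ring
  push_cast at hz1 hz2
  refine ⟨k, l, rfl, by omega, hl', by linarith, by linarith, ?_⟩
  rw [abs_le]
  constructor <;> linarith

lemma meanCount_ratio (h : IsLarge n) {z : ℤ}
    (hz : |(z : ℝ) - n / 2| ≤ windowRadius n (3 / 2) / 2 + 3) :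
    |meanCount n (z + 1) - meanCount n z| ≤
        1 / (8 * Real.log (Real.log n)) * meanCount n z ∧
      |meanCount n (z - 1) - meanCount n z| ≤
        1 / (8 * Real.log (Real.log n)) * meanCount n z := by
  obtain ⟨k, l, rfl, hk1, hkl, hk, hl, hd⟩ := h.window_bounds hz
  obtain ⟨j, rfl⟩ := Nat.exists_eq_add_of_le' hk1
  have hS := h.windowRadius_le (c := 3 / 2) (by norm_num)
  have hr := h.large_sqrt
  have hl1 := h.one_le_log
  have hn : (n : ℝ) = √n ^ 2 := (Real.sq_sqrt n.cast_nonneg).symm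
  set L := Real.log (Real.log n)
  set ℓ := Real.log n
  set r := √(n : ℝ)
  have hL0 : 1 ≤ L := h.one_le_log_log
  have hLle : L ≤ ℓ := h.log_log_le
  have hℓr : 10000 * ℓ ^ 2 ≤ r := h.log_sq_le
  have hm1 : 0 ≤ meanCount n ((j + 1 : ℕ) : ℤ) := meanCount_nonneg _ _
  have hd' : |((j + 1 : ℕ) : ℝ) - l| + 1 ≤ 2 * (r * ℓ) := by nlinarith
  have key : ∀ t : ℝ, (n : ℝ) / 4 ≤ t → 2 * (r * ℓ) ≤ 1 / (8 * L) * t := by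
    intro t ht
    rw [div_mul_eq_mul_div, le_div_iff₀ (by positivity), one_mul]
    refine le_trans ?_ ht
    have : r * ℓ * L ≤ r * ℓ * ℓ := mul_le_mul_of_nonneg_left hLle (by positivity)
    nlinarith
  have hR : ∀ t a b s : ℝ, (n : ℝ) / 4 ≤ t → 0 ≤ a → (b - a) * t = a * s →
      |s| ≤ 2 * (r * ℓ) → |b - a| ≤ 1 / (8 * L) * a := by
    intro t a b s ht ha hb hs
    have ht0 : 0 < t := lt_of_lt_of_le (by nlinarith) ht
    have h1 : |b - a| * t = a * |s| := by
      rw [← abs_of_pos ht0, ← abs_mul, hb, abs_mul, abs_of_nonneg ha]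
    have h2 : a * |s| ≤ a * (1 / (8 * L) * t) :=
      mul_le_mul_of_nonneg_left (hs.trans (key t ht)) ha
    have h3 : |b - a| * t ≤ (1 / (8 * L) * a) * t := by rw [h1]; linarith
    exact le_of_mul_le_mul_right h3 ht0
  have absd : ∀ s : ℝ, |s| ≤ |((j + 1 : ℕ) : ℝ) - l| + 1 → |s| ≤ 2 * (r * ℓ) :=
    fun s hs => hs.trans hd'
  constructor
  · refine hR (((j + 1 : ℕ) : ℝ) + 1) _ _ ((l : ℝ) - (j + 1 : ℕ) - 1) (by linarith) hm1 ?_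
      (absd _ ?_)
    · have h1 := Nat.choose_succ_right_eq (n - 1) (j + 1)
      rw [show n - 1 - (j + 1) = l by omega] at h1
      have h2 : ((n - 1).choose (j + 1 + 1) : ℝ) * ((j + 1 : ℕ) + 1) =
        (n - 1).choose (j + 1) * l := by exact_mod_cast h1
      have e : (((j + 1 : ℕ) : ℤ) + 1).toNat = j + 1 + 1 := by omega
      unfold meanCount
      rw [e, Int.toNat_natCast]
      field_simp
      push_cast at h2 ⊢
      linear_combination (n : ℝ) * h2
    · calc |(l : ℝ) - (j + 1 : ℕ) - 1| ≤ |(l : ℝ) - (j + 1 : ℕ)| + |(1 : ℝ)| := abs_sub _ _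
        _ = _ := by rw [abs_one, abs_sub_comm]
  · refine hR ((l : ℝ) + 1) _ _ (((j + 1 : ℕ) : ℝ) - l - 1) (by linarith) hm1 ?_
      (absd _ ?_)
    · have h1 := Nat.choose_succ_right_eq (n - 1) j
      rw [show n - 1 - j = l + 1 by omega] at h1
      have h2 : ((n - 1).choose (j + 1) : ℝ) * (j + 1) =
        (n - 1).choose j * (l + 1) := by exact_mod_cast h1
      have e : (((j + 1 : ℕ) : ℤ) - 1).toNat = j := by omega
      unfold meanCount
      rw [e, Int.toNat_natCast]
      field_simp
      push_cast
      linear_combination -(n : ℝ) * h2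
    · calc |((j + 1 : ℕ) : ℝ) - l - 1| ≤ |((j + 1 : ℕ) : ℝ) - l| + |(1 : ℝ)| := abs_sub _ _
        _ = _ := by rw [abs_one]

end IsLarge

lemma eventually_le_meanCount :
    ∀ᶠ n : ℕ in atTop, IsLarge n → ∀ z : ℤ,
      |(z : ℝ) - n / 2| ≤ windowRadius n (3 / 2) / 2 + 3 →
        3 / 2 * Real.log n ^ ((3 : ℝ) / 4) ≤ meanCount n z := by
  obtain ⟨K, hK⟩ := exists_forall_log_choose_ge
  filter_upwards [eventually_ge_atTop (4 * K)] with n hnK h z hz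
  obtain ⟨k, l, rfl, hk1, hkl, hk, hl, hd⟩ := h.window_bounds hz
  have hS := h.windowRadius_le (c := 3 / 2) (by norm_num)
  have hS2 := h.windowRadius_sq (c := 3 / 2) (by norm_num)
  have hr := h.large_sqrt
  have hl1 := h.one_le_log
  have hlr := h.log_le_sqrt
  have hn : (n : ℝ) = √n ^ 2 := (Real.sq_sqrt n.cast_nonneg).symm
  have hnK' : (4 : ℝ) * K ≤ n := by exact_mod_cast hnK
  have hsum : (k : ℝ) + l = n - 1 := by
    have : k + l + 1 = n := by omega
    rw [← this]; push_cast; ring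
  set S := windowRadius n (3 / 2) with hSdef
  have hS0 : 0 ≤ S := Real.sqrt_nonneg _
  set L := Real.log (Real.log n)
  have hL0 : 1 ≤ L := h.one_le_log_log
  have hℓr : 10000 * Real.log n ^ 2 ≤ √n := h.log_sq_le
  have hlog2pi : 0 ≤ Real.log (2 * Real.pi) := Real.log_nonneg (by linarith [Real.pi_gt_three])
  have hn0 : (10000 : ℝ) ≤ n := by rw [hn]; nlinarith
  have hmain := hK k l (by exact_mod_cast (by linarith : (K : ℝ) ≤ k))
    (by exact_mod_cast (by linarith : (K : ℝ) ≤ l)) (by rw [hsum]; refine hd.trans ?_; nlinarith)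
  have hlogm : Real.log ((k : ℝ) + l) ≤ Real.log n :=
    Real.log_le_log (by linarith) (by linarith)
  rw [hkl] at hmain
  set a := Real.log n - Real.log (2 * Real.pi) - 3 / 2 * L with ha
  have ha1 : a ≤ Real.log n := by linarith
  set ℓ := Real.log n with hℓ
  set r := √(n : ℝ)
  set u := (k : ℝ) - l
  set m := (k : ℝ) + l with hm
  have hm2 : (n : ℝ) / 2 ≤ m := by linarith
  have hm0 : 0 < m := by linarith
  have hrℓ : 10000 ≤ r * ℓ := hr.trans (le_mul_of_one_le_right (by linarith) hl1)
  have hrℓn : r * ℓ ≤ n / 10000 := by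
    have := mul_le_mul_of_nonneg_left hlr (by linarith : 0 ≤ r)
    rw [hn]
    linarith
  have husq : u ^ 2 ≤ n * a + 63 * (r * ℓ) := by
    have h1 : u ^ 2 ≤ (S + 7) ^ 2 := by
      rw [← sq_abs u]; exact pow_le_pow_left₀ (abs_nonneg _) hd 2
    linarith
  have husq' : u ^ 2 ≤ 4 * (r * ℓ) ^ 2 := by
    have h1 : u ^ 2 ≤ (2 * (r * ℓ)) ^ 2 := by
      rw [← sq_abs u]
      exact pow_le_pow_left₀ (abs_nonneg _) (hd.trans (by linarith)) 2
    linarith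
  have t1 : u ^ 2 / (2 * m) ≤ a / 2 + 1 / 100 := by
    rw [div_le_iff₀ (by positivity)]
    have h1 : (n : ℝ) * a = m * a + a := by rw [hsum]; ring
    have h3 : ℓ ≤ r * ℓ := le_mul_of_one_le_left (by linarith) (by linarith)
    linarith
  have t2 : 5 * u ^ 4 / (2 * m ^ 3) ≤ 1 / 100 := by
    rw [div_le_iff₀ (by positivity)]
    have h1 : u ^ 4 ≤ 16 * (r * ℓ) ^ 4 := by
      calc u ^ 4 = (u ^ 2) ^ 2 := by ring
        _ ≤ (4 * (r * ℓ) ^ 2) ^ 2 := pow_le_pow_left₀ (sq_nonneg _) husq' 2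
        _ = _ := by ring
    have h2 : (n / 2 : ℝ) ^ 3 ≤ m ^ 3 := pow_le_pow_left₀ (by linarith) hm2 3
    have h3 : (10000 * ℓ ^ 2) ^ 2 ≤ r ^ 2 := pow_le_pow_left₀ (by positivity) hℓr 2
    have h4 : r ^ 4 * (10000 * ℓ ^ 2) ^ 2 ≤ r ^ 4 * r ^ 2 :=
      mul_le_mul_of_nonneg_left h3 (by positivity)
    have h5 : (n / 2 : ℝ) ^ 3 = r ^ 4 * r ^ 2 / 8 := by rw [hn]; ring
    have h6 : (r * ℓ) ^ 4 * 100000000 = r ^ 4 * (10000 * ℓ ^ 2) ^ 2 := by ring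
    have h7 : 0 ≤ r ^ 4 * r ^ 2 := by positivity
    linarith
  have hnum : Real.log (3 / 2) + 2 * Real.log (11 / 10) + 1 / 50 ≤ Real.log 2 := by
    have h1 := Real.one_sub_inv_le_log_of_pos (x := 2 / (3 / 2 * (11 / 10) ^ 2)) (by norm_num)
    rw [Real.log_div two_ne_zero (by norm_num), Real.log_mul (by norm_num) (by norm_num),
      Real.log_pow] at h1
    push_cast at h1
    norm_num at h1 ⊢
    linarith
  have hCpos : (0 : ℝ) < (n - 1).choose k := by
    exact_mod_cast Nat.choose_pos (by omega : k ≤ n - 1)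
  have hmean : Real.log (meanCount n (k : ℤ)) =
      ℓ + (Real.log ((n - 1).choose k : ℝ) - m * Real.log 2) := by
    rw [meanCount, Int.toNat_natCast, Real.log_mul (by positivity) (by positivity),
      Real.log_div hCpos.ne' (by positivity), Real.log_pow, ← hkl]
    push_cast
    rfl
  have hmpos : 0 < meanCount n (k : ℤ) := by
    rw [meanCount, Int.toNat_natCast]
    positivity
  rw [← Real.log_le_log_iff (by positivity) hmpos, hmean,
    Real.log_mul (by norm_num) (by positivity), Real.log_rpow (by positivity)]
  rw [Real.log_mul two_ne_zero Real.pi_ne_zero] at ha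
  have hLe : Real.log ℓ = L := rfl
  rw [hLe]
  linarith

section Deterministic

variable {N μ : ℤ → ℝ} {ε : ℝ} {y : ℤ}

lemma concentrated_neighbours {b : ℝ} (hε0 : 0 < ε) (hε : ε ≤ 1 / 8) (hb : 0 < b)
    (hμ : ∀ z ∈ Finset.Icc (y - 2) (y + 2), 3 / 2 * b ≤ μ z ∧
      |μ (z + 1) - μ z| ≤ ε * μ z ∧ |μ (z - 1) - μ z| ≤ ε * μ z)
    (hN : ∀ z ∈ Finset.Icc (y - 2) (y + 2), |N z - μ z| ≤ ε * μ z) :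
    ∀ w ∈ ({y - 1, y, y + 1} : Set ℤ), b ≤ N w ∧
      |N w - N (w + 1)| ≤ N w * (8 * ε) ∧ |N w - N (w - 1)| ≤ N w * (8 * ε) := by
  have aux : ∀ x x' u u' : ℝ, 0 < u → |x - u| ≤ ε * u → |x' - u'| ≤ ε * u' →
      |u' - u| ≤ ε * u → |x - x'| ≤ x * (8 * ε) := by
    intro x x' u u' hu h1 h2 h3
    rw [abs_le] at *
    have h4 : ε * u' ≤ ε * (u * (9 / 8)) := mul_le_mul_of_nonneg_left (by nlinarith) hε0.le
    have h5 : ε * (u * (7 / 8)) ≤ ε * x := mul_le_mul_of_nonneg_left (by nlinarith) hε0.le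
    have h6 : 0 < ε * u := by positivity
    constructor <;> nlinarith
  intro w hw
  have hw' : y - 1 ≤ w ∧ w ≤ y + 1 := by
    rcases hw with rfl | rfl | rfl <;> omega
  obtain ⟨m1, m2, m3⟩ := hμ w (by rw [Finset.mem_Icc]; omega)
  have hw0 := hN w (by rw [Finset.mem_Icc]; omega)
  have hw1 := hN (w + 1) (by rw [Finset.mem_Icc]; omega)
  have hw2 := hN (w - 1) (by rw [Finset.mem_Icc]; omega)
  have hpos : 0 < μ w := by linarith
  refine ⟨?_, aux _ _ _ _ hpos hw0 hw1 m2, aux _ _ _ _ hpos hw0 hw2 m3⟩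
  have := (abs_le.1 hw0).1
  nlinarith

lemma le_sum_deviations (hε0 : 0 < ε) (hε : ε ≤ 1 / 8)
    (hμ : ∀ z ∈ Finset.Icc (y - 2) (y + 2), 0 < μ z ∧
      |μ (z + 1) - μ z| ≤ ε * μ z ∧ |μ (z - 1) - μ z| ≤ ε * μ z)
    (hN : ∃ z ∈ Finset.Icc (y - 2) (y + 2), ε * μ z < |N z - μ z|) :
    N y ≤ ∑ z ∈ Finset.Icc (y - 2) (y + 2), 8 / (ε ^ 2 * μ z) * (N z - μ z) ^ 2 := by
  have hnn : ∀ z ∈ Finset.Icc (y - 2) (y + 2), 0 ≤ 8 / (ε ^ 2 * μ z) * (N z - μ z) ^ 2 := by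
    intro z hz
    have := (hμ z hz).1
    positivity
  have hmem : y ∈ Finset.Icc (y - 2) (y + 2) := by rw [Finset.mem_Icc]; omega
  have hdev : ∀ z ∈ Finset.Icc (y - 2) (y + 2), ε * μ z < |N z - μ z| →
      8 * μ z ≤ 8 / (ε ^ 2 * μ z) * (N z - μ z) ^ 2 ∧
        8 * ε * |N z - μ z| ≤ ε ^ 2 * (8 / (ε ^ 2 * μ z) * (N z - μ z) ^ 2) := by
    intro z hz h
    have h0 := (hμ z hz).1
    have h1 : (N z - μ z) ^ 2 = |N z - μ z| ^ 2 := (sq_abs _).symm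
    rw [h1]
    set d := |N z - μ z|
    have hd : 0 < d := lt_of_le_of_lt (by positivity) h
    constructor
    · rw [div_mul_eq_mul_div, le_div_iff₀ (by positivity)]
      have : (ε * μ z) ^ 2 ≤ d ^ 2 := pow_le_pow_left₀ (by positivity) h.le 2
      nlinarith
    · have e : ε ^ 2 * (8 / (ε ^ 2 * μ z) * d ^ 2) = 8 * d ^ 2 / μ z := by field_simp
      rw [e, le_div_iff₀ h0]
      nlinarith
  have hy0 := (hμ y hmem).1
  by_cases hy : ε * μ y < |N y - μ y|
  · refine le_trans ?_ (Finset.single_le_sum hnn hmem)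
    obtain ⟨h1, h2⟩ := hdev y hmem hy
    set Q := 8 / (ε ^ 2 * μ y) * (N y - μ y) ^ 2
    have hQ : 0 < Q := lt_of_lt_of_le (by positivity) h1
    have h3 : 8 * |N y - μ y| ≤ ε * Q := by nlinarith
    have h4 := le_abs_self (N y - μ y)
    nlinarith
  · obtain ⟨z, hz, hd⟩ := hN
    refine le_trans ?_ (Finset.single_le_sum hnn hz)
    refine le_trans ?_ (hdev z hz hd).1
    have hNy : N y ≤ 9 / 8 * μ y := by
      have := (abs_le.1 (not_lt.1 hy)).2
      nlinarith
    have up : ∀ w ∈ Finset.Icc (y - 2) (y + 2), μ (w + 1) ≤ 9 / 8 * μ w ∧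
        μ (w - 1) ≤ 9 / 8 * μ w := by
      intro w hw
      obtain ⟨h0, h1, h2⟩ := hμ w hw
      have h1 := (abs_le.1 h1).2
      have h2 := (abs_le.1 h2).2
      constructor <;> nlinarith
    have hz0 := (hμ z hz).1
    obtain ⟨ha, hb⟩ := Finset.mem_Icc.1 hz
    obtain rfl | rfl | rfl | rfl | rfl :
        z = y - 2 ∨ z = y - 1 ∨ z = y ∨ z = y + 1 ∨ z = y + 2 := by omega
    · have h1 := (up (y - 2) hz).1
      have h2 := (up (y - 1) (by rw [Finset.mem_Icc]; omega)).1
      rw [show y - 2 + 1 = y - 1 by ring] at h1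
      rw [sub_add_cancel] at h2
      linarith
    · have h2 := (up (y - 1) hz).1
      rw [sub_add_cancel] at h2
      linarith
    · linarith
    · have h2 := (up (y + 1) hz).2
      rw [add_sub_cancel_right] at h2
      linarith
    · have h1 := (up (y + 2) hz).2
      have h2 := (up (y + 1) (by rw [Finset.mem_Icc]; omega)).2
      rw [show y + 2 - 1 = y + 1 by ring] at h1
      rw [add_sub_cancel_right] at h2
      linarith

end Deterministic

lemma eventually_isLarge : ∀ᶠ n : ℕ in atTop, IsLarge n := by
  have hlog : Tendsto (fun n : ℕ => Real.log n) atTop atTop :=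
    Real.tendsto_log_atTop.comp tendsto_natCast_atTop_atTop
  have h1 := (Real.tendsto_log_atTop.comp hlog).eventually_ge_atTop 1
  have h2 := (tendsto_natCast_atTop_atTop (R := ℝ)).eventually
    ((Real.isLittleO_pow_log_id_atTop (n := 4)).bound (by norm_num : (0 : ℝ) < 1 / 100000000))
  have h3 := hlog.eventually (Real.isLittleO_log_id_atTop.bound (by norm_num : (0 : ℝ) < 1 / 10))
  have h4 := hlog.eventually_ge_atTop (max 1 (4 * Real.log (2 * Real.pi)))
  filter_upwards [h1, h2, h3, h4] with n h1 h2 h3 h4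
  have hl1 : 1 ≤ Real.log n := (le_max_left _ _).trans h4
  have hl2 : 4 * Real.log (2 * Real.pi) ≤ Real.log n := (le_max_right _ _).trans h4
  refine ⟨h1, ?_, ?_⟩
  · rw [Real.norm_of_nonneg (by positivity), id, Real.norm_of_nonneg n.cast_nonneg] at h2
    refine Real.le_sqrt_of_sq_le ?_
    nlinarith
  · have h5 := (le_abs_self _).trans h3
    rw [id, Real.norm_of_nonneg (by linarith)] at h5
    linarith

/-- A finite set containing the integers `y` with
`windowRadius n (5 / 2) / 2 ≤ |y - n / 2| ≤ windowRadius n (3 / 2) / 2`. -/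
noncomputable def degreeWindow (n : ℕ) : Finset ℤ :=
  Finset.Icc ⌈(n : ℝ) / 2 + windowRadius n (5 / 2) / 2⌉
      ⌊(n : ℝ) / 2 + windowRadius n (3 / 2) / 2⌋ ∪
    Finset.Icc ⌈(n : ℝ) / 2 - windowRadius n (3 / 2) / 2⌉
      ⌊(n : ℝ) / 2 - windowRadius n (5 / 2) / 2⌋

lemma mem_degreeWindow {n : ℕ} {y : ℤ} (h1 : windowRadius n (5 / 2) / 2 ≤ |(y : ℝ) - n / 2|)
    (h2 : |(y : ℝ) - n / 2| ≤ windowRadius n (3 / 2) / 2) : y ∈ degreeWindow n := by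
  rw [degreeWindow, Finset.mem_union, Finset.mem_Icc, Finset.mem_Icc, Int.ceil_le, Int.le_floor,
    Int.ceil_le, Int.le_floor]
  rcases abs_cases ((y : ℝ) - n / 2) with h | h
  · left; constructor <;> linarith
  · right; constructor <;> linarith

lemma abs_sub_le_of_mem_degreeWindow {n : ℕ} {y : ℤ} (h : y ∈ degreeWindow n) :
    |(y : ℝ) - n / 2| ≤ windowRadius n (3 / 2) / 2 := by
  have h0 : 0 ≤ windowRadius n (5 / 2) := Real.sqrt_nonneg _
  rw [degreeWindow, Finset.mem_union, Finset.mem_Icc, Finset.mem_Icc, Int.ceil_le, Int.le_floor,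
    Int.ceil_le, Int.le_floor] at h
  rw [abs_le]
  rcases h with h | h <;> constructor <;> linarith [h.1, h.2]

lemma card_Icc_ceil_floor_le {a b : ℝ} (h : a ≤ b) :
    ((Finset.Icc ⌈a⌉ ⌊b⌋).card : ℝ) ≤ b - a + 1 := by
  rw [Int.card_Icc]
  rcases le_total 0 (⌊b⌋ + 1 - ⌈a⌉) with h0 | h0
  · have : (((⌊b⌋ + 1 - ⌈a⌉).toNat : ℤ) : ℝ) = ((⌊b⌋ + 1 - ⌈a⌉ : ℤ) : ℝ) := by
      rw [Int.toNat_of_nonneg h0]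
    rw [Int.cast_natCast] at this
    rw [this]
    push_cast
    linarith [Int.floor_le b, Int.le_ceil a]
  · rw [Int.toNat_of_nonpos h0]
    push_cast
    linarith

lemma card_degreeWindow_le {n : ℕ} (h : IsLarge n) :
    ((degreeWindow n).card : ℝ) ≤
      2 * (√n * Real.log (Real.log n)) / √(Real.log n) + 2 := by
  have h1 := h.windowRadius_sq (c := 3 / 2) (by norm_num)
  have h2 := h.windowRadius_sq (c := 5 / 2) le_rfl
  have hL := h.one_le_log_log
  have hl := h.one_le_log
  have hl2 := h.log_two_pi_le
  have hr := h.large_sqrt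
  have hn : (n : ℝ) = √n ^ 2 := (Real.sq_sqrt n.cast_nonneg).symm
  have hS2 : 0 ≤ windowRadius n (5 / 2) := Real.sqrt_nonneg _
  have hS1 : √n * √(Real.log n) / 2 ≤ windowRadius n (3 / 2) := by
    refine Real.le_sqrt_of_sq_le ?_
    rw [div_pow, mul_pow, Real.sq_sqrt n.cast_nonneg, Real.sq_sqrt (by linarith)]
    rw [mul_div_assoc]
    exact mul_le_mul_of_nonneg_left (by linarith) n.cast_nonneg
  set S₁ := windowRadius n (3 / 2)
  set S₂ := windowRadius n (5 / 2)
  set L := Real.log (Real.log n)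
  set s := √(Real.log n) with hs
  set r := √(n : ℝ)
  have hs0 : 0 < s := Real.sqrt_pos.2 (by linarith)
  have hS1pos : 0 < S₁ := lt_of_lt_of_le (by positivity) hS1
  have hsq : S₁ ^ 2 - S₂ ^ 2 = r ^ 2 * L := by rw [h1, h2, ← hn]; ring
  have hle : S₂ ≤ S₁ := by
    refine le_of_sq_le_sq ?_ hS1pos.le
    nlinarith [mul_nonneg (sq_nonneg r) (zero_le_one.trans hL)]
  have hdiff : S₁ - S₂ ≤ 2 * (r * L) / s := by
    rw [le_div_iff₀ hs0]
    have h3 : (S₁ - S₂) * S₁ ≤ r ^ 2 * L := by nlinarith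
    have h4 : (S₁ - S₂) * (r * s / 2) ≤ r ^ 2 * L :=
      (mul_le_mul_of_nonneg_left hS1 (by linarith)).trans h3
    have h5 : r * ((S₁ - S₂) * s) ≤ r * (2 * (r * L)) := by linarith
    exact le_of_mul_le_mul_left h5 (by linarith)
  have hc : ((degreeWindow n).card : ℝ) ≤ (S₁ / 2 - S₂ / 2 + 1) + (S₁ / 2 - S₂ / 2 + 1) := by
    refine (Nat.cast_le.2 (Finset.card_union_le _ _)).trans ?_
    push_cast
    refine add_le_add ((card_Icc_ceil_floor_le (by linarith)).trans (by linarith))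
      ((card_Icc_ceil_floor_le (by linarith)).trans (by linarith))
  linarith

lemma gprob_eq_sum {n : ℕ} (A : Set (SimpleGraph (Fin n))) [DecidablePred (· ∈ A)] :
    gprob A = (∑ G : SimpleGraph (Fin n), if G ∈ A then (1 : ℝ) else 0) / 2 ^ (n.choose 2) := by
  rw [gprob, Finset.sum_boole, Nat.card_eq_card_toFinset, Nat.card_eq_fintype_card,
    Fintype.card_fin]
  congr 3
  ext G
  simp

lemma gprob_le_one {n : ℕ} (A : Set (SimpleGraph (Fin n))) : gprob A ≤ 1 := by
  classical
  rw [gprob_eq_sum, div_le_one (by positivity), ← sum_graph_one]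
  refine Finset.sum_le_sum fun G _ => ?_
  split_ifs <;> norm_num

/-- Markov's inequality for a uniformly random graph. -/
lemma one_sub_div_le_gprob {n : ℕ} (X : SimpleGraph (Fin n) → ℝ) (hX : ∀ G, 0 ≤ X G) {B r : ℝ}
    (hr : 0 < r) (hB : ∑ G, X G ≤ 2 ^ (n.choose 2) * B) :
    1 - B / r ≤ gprob {G | X G ≤ r} := by
  classical
  rw [gprob_eq_sum, le_div_iff₀ (by positivity)]
  have h1 : ∑ G : SimpleGraph (Fin n), (1 - X G / r) ≤
      ∑ G : SimpleGraph (Fin n), if G ∈ {G | X G ≤ r} then (1 : ℝ) else 0 := by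
    refine Finset.sum_le_sum fun G _ => ?_
    have := hX G
    by_cases h : G ∈ {G | X G ≤ r}
    · rw [if_pos h]
      have : 0 ≤ X G / r := by positivity
      linarith
    · rw [if_neg h]
      have : 1 ≤ X G / r := (one_le_div hr).2 (not_le.1 (show ¬ X G ≤ r from h)).le
      linarith
  refine le_trans ?_ h1
  rw [Finset.sum_sub_distrib, sum_graph_one, ← Finset.sum_div]
  have := div_le_div_of_nonneg_right hB hr.le
  rw [mul_div_assoc] at this
  linarith

open Finset in
lemma ncard_setOf_not_le_sum {n : ℕ} (G : SimpleGraph (Fin n)) (W : Finset ℤ) (Q : ℕ → Prop)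
    (R : ℤ → ℝ) (hR : ∀ y ∈ W, 0 ≤ R y)
    (h : ∀ d : ℕ, ¬ Q d → (d : ℤ) ∈ W ∧ (Ncount G d : ℝ) ≤ R d) :
    (Set.ncard {i : Fin n | ¬ Q (ndeg G i)} : ℝ) ≤ ∑ y ∈ W, R y := by
  classical
  have e : Set.ncard {i : Fin n | ¬ Q (ndeg G i)} =
      #{i : Fin n | ¬ Q (ndeg G i)} := by
    rw [← Set.ncard_coe_finset]
    simp
  rw [e, card_eq_sum_card_fiberwise (f := fun i => (ndeg G i : ℤ)) (t := W)]
  · push_cast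
    refine sum_le_sum fun y hy => ?_
    rcases eq_empty_or_nonempty
      {i ∈ ({i : Fin n | ¬ Q (ndeg G i)} : Finset (Fin n)) | (ndeg G i : ℤ) = y} with h0 | ⟨i, hi⟩
    · rw [h0]
      simpa using hR y hy
    · simp only [mem_filter, mem_univ, true_and] at hi
      obtain ⟨hi, rfl⟩ := hi
      refine le_trans ?_ (h _ hi).2
      rw [Nat.cast_le, Ncount, ← Set.ncard_coe_finset]
      refine Set.ncard_le_ncard ?_ (Set.toFinite _)
      intro j hj
      simp only [coe_filter, mem_filter, Set.mem_ofPred_eq] at hj ⊢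
      exact hj.2
  · intro i hi
    simp only [coe_filter, mem_univ, true_and, Set.mem_ofPred_eq] at hi
    exact (h _ hi).1

lemma tendsto_error :
    Tendsto (fun n : ℕ => 20480 * (Real.log (Real.log n) ^ 3 / √(Real.log n)))
      atTop (nhds 0) := by
  have hlog : Tendsto (fun n : ℕ => Real.log n) atTop atTop :=
    Real.tendsto_log_atTop.comp tendsto_natCast_atTop_atTop
  have h := (isLittleO_log_rpow_rpow_atTop (s := 1 / 2) 3 (by norm_num)).tendsto_div_nhds_zero
  have h2 := (h.comp hlog).const_mul 20480
  rw [mul_zero] at h2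
  refine h2.congr fun n => ?_
  simp only [Function.comp]
  rw [Real.sqrt_eq_rpow]
  norm_cast

open Finset in
lemma sum_deviations_le {n : ℕ} (h : IsLarge n) (hpos : ∀ y ∈ degreeWindow n,
      ∀ z ∈ Icc (y - 2) (y + 2), 1 ≤ z ∧ 0 < meanCount n z) :
    ∑ G : SimpleGraph (Fin n), ∑ y ∈ degreeWindow n, ∑ z ∈ Icc (y - 2) (y + 2),
        8 / ((1 / (8 * Real.log (Real.log n))) ^ 2 * meanCount n z) *
          ((Ncount G z : ℝ) - meanCount n z) ^ 2 ≤
      2 ^ (n.choose 2) * (#(degreeWindow n) * (5120 * Real.log (Real.log n) ^ 2)) := by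
  have hL := h.one_le_log_log
  set L := Real.log (Real.log n)
  have hn2 : 2 ≤ n := by
    by_contra! hlt
    have : Real.log n ≤ 0 := Real.log_nonpos n.cast_nonneg (by exact_mod_cast (by omega : n ≤ 1))
    linarith [h.one_le_log]
  rw [sum_comm]
  calc _ ≤ ∑ y ∈ degreeWindow n, ∑ z ∈ Icc (y - 2) (y + 2),
        2 ^ (n.choose 2) * (1024 * L ^ 2) := by
        refine sum_le_sum fun y hy => ?_
        rw [sum_comm]
        refine sum_le_sum fun z hz => ?_
        obtain ⟨hz1, hz2⟩ := hpos y hy z hz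
        rw [← mul_sum]
        refine (mul_le_mul_of_nonneg_left (sum_Ncount_sub_sq_le hn2 hz1)
          (by positivity)).trans_eq ?_
        field_simp
        norm_num
    _ = _ := by
      simp only [sum_const, Int.card_Icc, nsmul_eq_mul]
      have : ∀ y : ℤ, (y + 2 + 1 - (y - 2)).toNat = 5 := fun y => by omega
      simp only [this, sum_const, nsmul_eq_mul]
      push_cast
      ring

lemma natCast_mul_log_mul_one_sub_div (n : ℕ) (h : 1 ≤ Real.log n) (c : ℝ) :
    (n : ℝ) * Real.log n *
        (1 - (Real.log (2 * Real.pi) + c * Real.log (Real.log n)) / Real.log n) =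
      n * (Real.log n - Real.log (2 * Real.pi) - c * Real.log (Real.log n)) := by
  have : Real.log n ≠ 0 := by linarith
  field_simp
  ring

/-- Whp, for all but at most `√n` vertices `i`: if the degree `ξ_i` satisfies
`(1/2)·√(n·ln n·(1−ζ₂)) ≤ |ξ_i − n/2| ≤ (1/2)·√(n·ln n·(1−ζ₁))`, then for each
`y ∈ {ξ_i − 1, ξ_i, ξ_i + 1}` one has `N_y ≥ (ln n)^{3/4}`,
`|N_y − N_{y+1}| ≤ N_y / ln ln n` and `|N_y − N_{y−1}| ≤ N_y / ln ln n`. -/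
theorem middle_degrees_whp :
    Tendsto (fun n : ℕ => gprob {G : SimpleGraph (Fin n) |
      ((Set.ncard {i : Fin n | ¬ (
        ((1 / 2) * Real.sqrt ((n : ℝ) * Real.log n * (1 - zeta2 n)) ≤
            |(ndeg G i : ℝ) - (n : ℝ) / 2| ∧
          |(ndeg G i : ℝ) - (n : ℝ) / 2| ≤
            (1 / 2) * Real.sqrt ((n : ℝ) * Real.log n * (1 - zeta1 n))) →
        ∀ y ∈ ({(ndeg G i : ℤ) - 1, (ndeg G i : ℤ), (ndeg G i : ℤ) + 1} : Set ℤ),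
          Real.log n ^ ((3 : ℝ) / 4) ≤ (Ncount G y : ℝ) ∧
          |(Ncount G y : ℝ) - (Ncount G (y + 1) : ℝ)| ≤
            (Ncount G y : ℝ) / Real.log (Real.log n) ∧
          |(Ncount G y : ℝ) - (Ncount G (y - 1) : ℝ)| ≤
            (Ncount G y : ℝ) / Real.log (Real.log n))} : ℕ) : ℝ)
        ≤ Real.sqrt n}) atTop (nhds 1) := by
  refine tendsto_of_tendsto_of_tendsto_of_le_of_le' (g := fun n : ℕ =>
    1 - 20480 * (Real.log (Real.log n) ^ 3 / √(Real.log n)))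
    (by simpa using tendsto_error.const_sub 1) tendsto_const_nhds ?_
    (Eventually.of_forall fun n => gprob_le_one _)
  filter_upwards [eventually_isLarge, eventually_le_meanCount] with n h hmean
  specialize hmean h
  have hL := h.one_le_log_log
  have hl := h.one_le_log
  have hr := h.large_sqrt
  have hcard := card_degreeWindow_le h
  have hnear : ∀ y ∈ degreeWindow n, ∀ z ∈ Finset.Icc (y - 2) (y + 2),
      |(z : ℝ) - n / 2| ≤ windowRadius n (3 / 2) / 2 + 3 := by
    intro y hy z hz
    have h1 := abs_le.1 (abs_sub_le_of_mem_degreeWindow hy)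
    rw [Finset.mem_Icc] at hz
    have h2 : (y : ℝ) - 2 ≤ z := by exact_mod_cast hz.1
    have h3 : (z : ℝ) ≤ y + 2 := by exact_mod_cast hz.2
    rw [abs_le]
    constructor <;> linarith [h1.1, h1.2]
  have hb : 0 < Real.log n ^ ((3 : ℝ) / 4) := by positivity
  have hpos : ∀ y ∈ degreeWindow n, ∀ z ∈ Finset.Icc (y - 2) (y + 2),
      1 ≤ z ∧ 0 < meanCount n z := by
    intro y hy z hz
    obtain ⟨k, l, rfl, hk, -⟩ := h.window_bounds (hnear y hy z hz)
    exact ⟨by exact_mod_cast hk, lt_of_lt_of_le (by positivity) (hmean _ (hnear y hy _ hz))⟩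
  set ε := 1 / (8 * Real.log (Real.log n)) with hε
  have hε0 : 0 < ε := by positivity
  have hε8 : ε ≤ 1 / 8 := by
    rw [hε]
    exact one_div_le_one_div_of_le (by norm_num) (by linarith)
  refine le_trans ?_ (one_sub_div_le_gprob _ (fun G => Nat.cast_nonneg _)
    (B := (degreeWindow n).card * (5120 * Real.log (Real.log n) ^ 2)) (by linarith)
    (le_trans (Finset.sum_le_sum fun G _ => ?_) (sum_deviations_le h hpos)))
  · have hs0 : 0 < √(Real.log n) := Real.sqrt_pos.2 (by linarith)
    have hsr : √(Real.log n) ≤ √(n : ℝ) :=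
      Real.sqrt_le_sqrt (Real.log_le_self n.cast_nonneg)
    set L := Real.log (Real.log n)
    set s := √(Real.log n)
    set r := √(n : ℝ)
    have hr0 : 0 < r := by linarith
    have h1 : ((degreeWindow n).card : ℝ) ≤ 4 * (r * L / s) := by
      have : 1 ≤ r * L / s := by
        rw [one_le_div hs0]
        nlinarith
      rw [mul_div_assoc] at hcard
      linarith
    have h2 : (degreeWindow n).card * (5120 * L ^ 2) / r ≤ 20480 * (L ^ 3 / s) := by
      rw [div_le_iff₀ hr0]
      calc _ ≤ 4 * (r * L / s) * (5120 * L ^ 2) :=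
            mul_le_mul_of_nonneg_right h1 (by positivity)
        _ = _ := by ring
    linarith
  · refine ncard_setOf_not_le_sum G (degreeWindow n) (fun d =>
        ((1 / 2) * Real.sqrt ((n : ℝ) * Real.log n * (1 - zeta2 n)) ≤
            |(d : ℝ) - (n : ℝ) / 2| ∧
          |(d : ℝ) - (n : ℝ) / 2| ≤
            (1 / 2) * Real.sqrt ((n : ℝ) * Real.log n * (1 - zeta1 n))) →
        ∀ y ∈ ({(d : ℤ) - 1, (d : ℤ), (d : ℤ) + 1} : Set ℤ),
          Real.log n ^ ((3 : ℝ) / 4) ≤ (Ncount G y : ℝ) ∧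
          |(Ncount G y : ℝ) - (Ncount G (y + 1) : ℝ)| ≤
            (Ncount G y : ℝ) / Real.log (Real.log n) ∧
          |(Ncount G y : ℝ) - (Ncount G (y - 1) : ℝ)| ≤
            (Ncount G y : ℝ) / Real.log (Real.log n))
        (fun y => ∑ z ∈ Finset.Icc (y - 2) (y + 2),
          8 / (ε ^ 2 * meanCount n z) * ((Ncount G z : ℝ) - meanCount n z) ^ 2) ?_ ?_
    · intro y hy
      refine Finset.sum_nonneg fun z hz => ?_
      have := (hpos y hy z hz).2
      positivity
    · intro d hd
      rw [Classical.not_imp] at hd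
      obtain ⟨⟨hd1, hd2⟩, hd3⟩ := hd
      rw [zeta2, natCast_mul_log_mul_one_sub_div n hl, ← windowRadius] at hd1
      rw [zeta1, natCast_mul_log_mul_one_sub_div n hl, ← windowRadius] at hd2
      have hdW : (d : ℤ) ∈ degreeWindow n :=
        mem_degreeWindow (by push_cast; linarith) (by push_cast; linarith)
      refine ⟨hdW, ?_⟩
      refine le_sum_deviations (N := fun z => (Ncount G z : ℝ)) (μ := meanCount n) hε0 hε8
        (fun z hz => ⟨(hpos _ hdW z hz).2, h.meanCount_ratio (hnear _ hdW z hz)⟩) ?_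
      by_contra! hN
      refine hd3 fun y hy => ?_
      have e : ∀ x : ℝ, x / Real.log (Real.log n) = x * (8 * ε) := by
        intro x
        rw [hε]
        field_simp
      rw [e]
      exact concentrated_neighbours (N := fun z => (Ncount G z : ℝ)) (μ := meanCount n) hε0 hε8 hb
        (fun z hz => ⟨hmean z (hnear _ hdW z hz), h.meanCount_ratio (hnear _ hdW z hz)⟩) hN y hy
end
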